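/- arXiv:2006.05551 — 6 statements merged into one kernel-verified Lean document; each statement's English description precedes it below -/
import Mathlib

section
/- Let k be a natural number, let β ∈ ℝ with β ≠ −1, and let h₀ : (0,∞) → ℂ satisfy the Hankel-type decay bounds up to order k+2. Suppose f : [0,1] → ℂ is (k+2)-times continuously differentiable and f⁽ʲ⁾(0) = f⁽ʲ⁾(1) = 0 for every j = 0,…,k. Then for every δ > 0 there exist constants C > 0 and ω₀ ≥ 1 such that for all ω ≥ ω₀, |∫₀¹ f(x) h₀(ωx) e^{iω(β+1)x} dx| ≤ C ω^{−(k+2)+δ}. -/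
open MeasureTheory Real Set

/-- A function whose first `k` members of its chain of derivatives vanish at `0` decays like a
power of `x` near `0`, with the constant bounding the `k + 1`-st member. -/
lemma norm_le_mul_pow_of_hasDerivWithinAt {k : ℕ} {F : ℕ → ℝ → ℂ} {M : ℝ}
    (hd : ∀ i ≤ k, ∀ x ∈ Icc (0:ℝ) 1, HasDerivWithinAt (F i) (F (i + 1) x) (Icc 0 1) x)
    (h0 : ∀ i ≤ k, F i 0 = 0) (hM : ∀ x ∈ Icc (0:ℝ) 1, ‖F (k + 1) x‖ ≤ M) (n : ℕ) :
    ∀ i, i + n = k + 1 → ∀ x ∈ Icc (0:ℝ) 1, ‖F i x‖ ≤ M * x ^ n := by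
  have hM0 : 0 ≤ M := (norm_nonneg _).trans (hM 0 (by simp))
  induction n with
  | zero =>
    intro i hi x hx
    obtain rfl : i = k + 1 := by omega
    simpa using hM x hx
  | succ n ih =>
    intro i hi x hx
    have hsub : Icc 0 x ⊆ Icc (0:ℝ) 1 := Icc_subset_Icc_right hx.2
    have key := norm_image_sub_le_of_norm_deriv_le_segment' (f := F i) (f' := F (i + 1))
      (a := 0) (b := x) (C := M * x ^ n)
      (fun y hy => (hd i (by omega) y (hsub hy)).mono hsub)
      (fun y hy => (ih (i + 1) (by omega) y (hsub (Ico_subset_Icc_self hy))).trans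
        (mul_le_mul_of_nonneg_left (pow_le_pow_left₀ hy.1 hy.2.le n) hM0))
      x ⟨hx.1, le_rfl⟩
    rw [h0 i (by omega), sub_zero, sub_zero] at key
    rwa [pow_succ, ← mul_assoc]

/-- One integration by parts in an oscillatory integral. -/
lemma norm_integral_mul_cexp_le {c d a : ℝ} (hcd : c ≤ d) (ha : a ≠ 0) {u u' : ℝ → ℂ}
    (hu : ∀ x ∈ Icc c d, HasDerivWithinAt u (u' x) (Icc c d) x)
    (hu' : ContinuousOn u' (Icc c d)) :
    ‖∫ x in c..d, u x * Complex.exp (Complex.I * ((a * x : ℝ) : ℂ))‖ ≤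
      (‖u d‖ + ‖u c‖ + ‖∫ x in c..d, u' x * Complex.exp (Complex.I * ((a * x : ℝ) : ℂ))‖)
        / |a| := by
  have haC : Complex.I * (a : ℂ) ≠ 0 := by simp [ha]
  have hv : ∀ x : ℝ, HasDerivAt
      (fun x : ℝ => Complex.exp (Complex.I * ((a * x : ℝ) : ℂ)) / (Complex.I * a))
      (Complex.exp (Complex.I * ((a * x : ℝ) : ℂ))) x := by
    intro x
    have h1 : HasDerivAt (fun x : ℝ => Complex.I * ((a * x : ℝ) : ℂ)) (Complex.I * a) x := by
      simpa using (((hasDerivAt_id x).const_mul a).ofReal_comp).const_mul Complex.I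
    have h2 := h1.cexp.div_const (Complex.I * a)
    rwa [mul_div_cancel_right₀ _ haC] at h2
  have hn : ∀ x : ℝ, ‖Complex.exp (Complex.I * ((a * x : ℝ) : ℂ))‖ = 1 := fun x => by
    rw [mul_comm]; exact Complex.norm_exp_ofReal_mul_I _
  rw [← uIcc_of_le hcd] at hu hu'
  rw [intervalIntegral.integral_mul_deriv_eq_deriv_mul_of_hasDerivWithinAt hu
    (fun x _ => (hv x).hasDerivWithinAt) hu'.intervalIntegrable
    (Continuous.intervalIntegrable (by fun_prop) _ _)]
  simp_rw [← mul_div_assoc]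
  rw [intervalIntegral.integral_div, ← sub_div, ← sub_div, norm_div]
  have hna : ‖Complex.I * (a : ℂ)‖ = |a| := by simp
  rw [hna]
  gcongr
  refine (norm_sub_le _ _).trans (add_le_add ((norm_sub_le _ _).trans ?_) le_rfl)
  simp only [norm_mul, hn, mul_one, le_refl]

/-- Repeated integration by parts for oscillatory integrals of products `F i * P p`, where `F` and
`P` are chains of derivatives, over `[ω⁻¹, 1]`. -/
lemma exists_norm_integral_mul_mul_cexp_le (N : ℕ) {b M : ℝ} (hb : 0 < b) (hM : 0 ≤ M) (n : ℕ) :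
    ∃ K : ℝ, 0 ≤ K ∧ ∀ ω : ℝ, 1 ≤ ω → ∀ a : ℝ, |a| = ω * b → ∀ F P : ℕ → ℝ → ℂ,
      (∀ i < N, ∀ x ∈ Icc ω⁻¹ 1, HasDerivWithinAt (F i) (F (i + 1) x) (Icc ω⁻¹ 1) x) →
      (∀ i < N, ∀ x ∈ Icc ω⁻¹ 1, HasDerivWithinAt (P i) (P (i + 1) x) (Icc ω⁻¹ 1) x) →
      (∀ i ≤ N, ContinuousOn (F i) (Icc ω⁻¹ 1)) →
      (∀ i ≤ N, ContinuousOn (P i) (Icc ω⁻¹ 1)) →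
      (∀ i p, i + p ≤ N → ∀ x ∈ Icc ω⁻¹ 1,
        ‖F i x * P p x‖ ≤ M * ω ^ (-(1 / 2) : ℝ) * x ^ ((N : ℝ) - 3 / 2 - ((i : ℝ) + p))) →
      (∀ i, i + 1 < N → F i 1 = 0) →
      ∀ i p, i + p + n = N →
        ‖∫ x in ω⁻¹..1, F i x * P p x * Complex.exp (Complex.I * ((a * x : ℝ) : ℂ))‖
          ≤ K * ω⁻¹ ^ n := by
  induction n with
  | zero =>
    refine ⟨2 * M, by positivity, fun ω hω a ha F P hF hP hFc hPc hB h1 i p hip => ?_⟩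
    have hω0 : 0 < ω := by linarith
    have hc0 : 0 < ω⁻¹ := inv_pos.2 hω0
    have hc1 : ω⁻¹ ≤ 1 := inv_le_one_of_one_le₀ hω
    have h0 : (0:ℝ) ∉ uIcc ω⁻¹ 1 := by
      rw [uIcc_of_le hc1]; exact fun h => absurd h.1 (not_le.2 hc0)
    have hint : IntervalIntegrable (fun x : ℝ => M * ω ^ (-(1 / 2) : ℝ) * x ^ (-(3 / 2) : ℝ))
        volume ω⁻¹ 1 :=
      (intervalIntegral.intervalIntegrable_rpow (Or.inr h0)).const_mul _
    refine (intervalIntegral.norm_integral_le_of_norm_le hc1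
      (Filter.Eventually.of_forall fun x hx => ?_) hint).trans ?_
    · rw [norm_mul, mul_comm Complex.I, Complex.norm_exp_ofReal_mul_I, mul_one]
      refine (hB i p (by omega) x (Ioc_subset_Icc_self hx)).trans (le_of_eq ?_)
      congr 2
      have : (i : ℝ) + p = N := by exact_mod_cast (by omega : i + p = N)
      rw [this]; ring
    · rw [intervalIntegral.integral_const_mul, integral_rpow (Or.inr ⟨by norm_num, h0⟩)]
      have e : (-(3 / 2) + 1 : ℝ) = -(1 / 2) := by norm_num
      rw [e, one_rpow, inv_rpow hω0.le, ← rpow_neg hω0.le, neg_neg]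
      have e2 : ω ^ (-(1 / 2) : ℝ) * ω ^ (1 / 2 : ℝ) = 1 := by
        rw [← rpow_add hω0]; norm_num
      have e3 : 0 < ω ^ (-(1 / 2) : ℝ) := rpow_pos_of_pos hω0 _
      have : M * ω ^ (-(1 / 2) : ℝ) * ((1 - ω ^ (1 / 2 : ℝ)) / -(1 / 2))
          = 2 * M * (ω ^ (-(1 / 2) : ℝ) * ω ^ (1 / 2 : ℝ)) - 2 * M * ω ^ (-(1 / 2) : ℝ) := by ring
      rw [this, e2]
      have := mul_nonneg hM e3.le
      simp only [pow_zero]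
      linarith
  | succ n ih =>
    obtain ⟨K, hK, ih⟩ := ih
    refine ⟨(2 * M + 2 * K) / b, by positivity,
      fun ω hω a ha F P hF hP hFc hPc hB h1 i p hip => ?_⟩
    have hω0 : 0 < ω := by linarith
    have hc0 : 0 < ω⁻¹ := inv_pos.2 hω0
    have hc1 : ω⁻¹ ≤ 1 := inv_le_one_of_one_le₀ hω
    have ha0 : a ≠ 0 := by
      rw [← abs_pos, ha]; positivity
    have i1 := ih ω hω a ha F P hF hP hFc hPc hB h1 (i + 1) p (by omega)
    have i2 := ih ω hω a ha F P hF hP hFc hPc hB h1 i (p + 1) (by omega)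
    have hcont : ∀ j q, j ≤ N → q ≤ N → ContinuousOn (fun x => F j x * P q x) (Icc ω⁻¹ 1) :=
      fun j q hj hq => (hFc j hj).mul (hPc q hq)
    have hcexp : ∀ j q, j ≤ N → q ≤ N → IntervalIntegrable (fun x =>
        F j x * P q x * Complex.exp (Complex.I * ((a * x : ℝ) : ℂ))) volume ω⁻¹ 1 := by
      intro j q hj hq
      apply ContinuousOn.intervalIntegrable
      rw [uIcc_of_le hc1]
      exact (hcont j q hj hq).mul (by fun_prop)
    have step := norm_integral_mul_cexp_le hc1 ha0 (u := fun x => F i x * P p x)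
      (u' := fun x => F (i + 1) x * P p x + F i x * P (p + 1) x)
      (fun x hx => (hF i (by omega) x hx).mul (hP p (by omega) x hx))
      ((hcont _ _ (by omega) (by omega)).add (hcont _ _ (by omega) (by omega)))
    simp_rw [add_mul] at step
    rw [intervalIntegral.integral_add (hcexp _ _ (by omega) (by omega))
      (hcexp _ _ (by omega) (by omega))] at step
    have hsum := norm_add_le
      (∫ x in ω⁻¹..1, F (i + 1) x * P p x * Complex.exp (Complex.I * ((a * x : ℝ) : ℂ)))
      (∫ x in ω⁻¹..1, F i x * P (p + 1) x * Complex.exp (Complex.I * ((a * x : ℝ) : ℂ)))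
    have hb1 : ‖F i 1 * P p 1‖ ≤ M * ω⁻¹ ^ n := by
      by_cases hi : i + 1 < N
      · rw [h1 i hi, zero_mul, norm_zero]; positivity
      · obtain rfl : n = 0 := by omega
        refine (hB i p (by omega) 1 ⟨hc1, le_rfl⟩).trans ?_
        rw [one_rpow, mul_one, pow_zero]
        exact mul_le_mul_of_nonneg_left (rpow_le_one_of_one_le_of_nonpos hω (by norm_num)) hM
    have hbc : ‖F i ω⁻¹ * P p ω⁻¹‖ ≤ M * ω⁻¹ ^ n := by
      refine (hB i p (by omega) ω⁻¹ ⟨le_rfl, hc1⟩).trans (le_of_eq ?_)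
      rw [mul_assoc, inv_rpow hω0.le, ← rpow_neg hω0.le, ← rpow_add hω0, inv_pow,
        ← rpow_natCast, ← rpow_neg hω0.le]
      congr 2
      have : (i : ℝ) + p + (n + 1) = N := by exact_mod_cast hip
      linarith
    refine step.trans ?_
    rw [ha]
    calc _ ≤ (M * ω⁻¹ ^ n + M * ω⁻¹ ^ n + (K * ω⁻¹ ^ n + K * ω⁻¹ ^ n)) / (ω * b) := by
          gcongr
          exact hsum.trans (add_le_add i1 i2)
      _ = (2 * M + 2 * K) / b * ω⁻¹ ^ (n + 1) := by
          rw [pow_succ]; field_simp; ring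

/-- A function in `Cᴺ(s)` has the iterated derivatives within `s` as a chain of derivatives. -/
lemma ContDiffOn.hasDerivWithinAt_iteratedDerivWithin {N n : ℕ} {g : ℝ → ℂ} {s : Set ℝ}
    (hg : ContDiffOn ℝ N g s) (hs : UniqueDiffOn ℝ s) (hn : n < N) {x : ℝ} (hx : x ∈ s) :
    HasDerivWithinAt (iteratedDerivWithin n g s) (iteratedDerivWithin (n + 1) g s x) s x := by
  rw [iteratedDerivWithin_succ]
  exact (hg.differentiableOn_iteratedDerivWithin (by exact_mod_cast hn) hs x hx).hasDerivWithinAt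

/-- On `(0, 1]` both `1 + log (1 / z)` and `z⁻ⁿ` are bounded by multiples of `z ^ (-(n + 1 / 2))`. -/
lemma max_one_add_log_rpow_le (n : ℕ) {z : ℝ} (hz : z ∈ Ioc (0:ℝ) 1) :
    max (1 + Real.log (1 / z)) (z ^ (-(n:ℝ))) ≤ 2 * z ^ (-((n:ℝ) + 1 / 2)) := by
  obtain ⟨hz0, hz1⟩ := hz
  have hle : ∀ {s t : ℝ}, t ≤ s → z ^ s ≤ z ^ t := fun h => rpow_le_rpow_of_exponent_ge hz0 hz1 h
  have hn : (0:ℝ) ≤ n := Nat.cast_nonneg n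
  have hpos : 0 < z ^ (-((n:ℝ) + 1 / 2)) := rpow_pos_of_pos hz0 _
  refine max_le ?_ ?_
  · have h1 : Real.log (z ^ (-(1 / 2) : ℝ)) ≤ z ^ (-(1 / 2) : ℝ) - 1 :=
      Real.log_le_sub_one_of_pos (rpow_pos_of_pos hz0 _)
    rw [Real.log_rpow hz0] at h1
    rw [one_div, Real.log_inv]
    have h2 : z ^ (-(1 / 2) : ℝ) ≤ z ^ (-((n:ℝ) + 1 / 2)) := hle (by linarith)
    linarith
  · have h2 : z ^ (-(n:ℝ)) ≤ z ^ (-((n:ℝ) + 1 / 2)) := hle (by linarith)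
    linarith

/-- **Filon paradigm for the first class of scattering integrals** (Proposition 2.2).
If `f ∈ C^{k+2}[0,1]` has its first `k` derivatives vanishing at both endpoints and
`h₀` satisfies the Hankel-type decay bounds up to order `k+2`, then for every `δ > 0`
the integral `∫₀¹ f(x) h₀(ωx) e^{iω(β+1)x} dx` is `O(ω^{-(k+2)+δ})` as `ω → ∞`. -/
theorem filon_paradigm_first_kind (k : ℕ) (β : ℝ) (hβ : β ≠ -1) (h₀ : ℝ → ℂ)
    (hsmooth : ContDiffOn ℝ (k + 2 : ℕ) h₀ (Ioi 0))
    (hdecay : ∀ n : ℕ, n ≤ k + 2 → ∃ C > (0:ℝ),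
      (∀ z ∈ Ioc (0:ℝ) 1,
        ‖iteratedDerivWithin n h₀ (Ioi 0) z‖ ≤ C * max (1 + Real.log (1 / z)) (z ^ (-(n:ℝ)))) ∧
      (∀ z ∈ Ici (1:ℝ),
        ‖iteratedDerivWithin n h₀ (Ioi 0) z‖ ≤ C * z ^ (-((n:ℝ) + 1 / 2))))
    (f : ℝ → ℂ) (hf : ContDiffOn ℝ (k + 2 : ℕ) f (Icc 0 1))
    (hf0 : ∀ j ≤ k, iteratedDerivWithin j f (Icc 0 1) 0 = 0)
    (hf1 : ∀ j ≤ k, iteratedDerivWithin j f (Icc 0 1) 1 = 0)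
    (δ : ℝ) (hδ : 0 < δ) :
    ∃ C > (0:ℝ), ∃ ω₀ : ℝ, 1 ≤ ω₀ ∧ ∀ ω : ℝ, ω₀ ≤ ω →
      ‖∫ x in (0:ℝ)..1, f x * h₀ (ω * x) * Complex.exp (Complex.I * ((ω * (β + 1) * x : ℝ) : ℂ))‖
        ≤ C * ω ^ (-((k:ℝ) + 2) + δ) := by
  set N := k + 2 with hN
  set F : ℕ → ℝ → ℂ := fun i => iteratedDerivWithin i f (Icc 0 1) with hFdef
  set H : ℕ → ℝ → ℂ := fun i => iteratedDerivWithin i h₀ (Ioi 0) with hHdef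
  have hsI : UniqueDiffOn ℝ (Icc (0:ℝ) 1) := uniqueDiffOn_Icc one_pos
  have hsH : UniqueDiffOn ℝ (Ioi (0:ℝ)) := uniqueDiffOn_Ioi 0
  have hFd : ∀ i < N, ∀ x ∈ Icc (0:ℝ) 1, HasDerivWithinAt (F i) (F (i + 1) x) (Icc 0 1) x :=
    fun i hi x hx => hf.hasDerivWithinAt_iteratedDerivWithin hsI hi hx
  have hHd : ∀ i < N, ∀ x ∈ Ioi (0:ℝ), HasDerivAt (H i) (H (i + 1) x) x :=
    fun i hi x hx => (hsmooth.hasDerivWithinAt_iteratedDerivWithin hsH hi hx).hasDerivAt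
      (Ioi_mem_nhds hx)
  have hFc : ∀ i ≤ N, ContinuousOn (F i) (Icc 0 1) := fun i hi =>
    hf.continuousOn_iteratedDerivWithin (by exact_mod_cast hi) hsI
  have hHc : ∀ i ≤ N, ContinuousOn (H i) (Ioi 0) := fun i hi =>
    hsmooth.continuousOn_iteratedDerivWithin (by exact_mod_cast hi) hsH
  obtain ⟨A₁, hA₁⟩ := isCompact_Icc.exists_bound_of_continuousOn (hFc (k + 1) (by omega))
  obtain ⟨A₂, hA₂⟩ := isCompact_Icc.exists_bound_of_continuousOn (hFc (k + 2) (by omega))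
  set A := max A₁ A₂
  have hA : 0 ≤ A := ((norm_nonneg _).trans (hA₁ 0 (by simp))).trans (le_max_left _ _)
  have hFb : ∀ i ≤ N, ∀ x ∈ Ioc (0:ℝ) 1, ‖F i x‖ ≤ A * x ^ ((N:ℝ) - 1 - i) := by
    intro i hi x hx
    have hx' : x ∈ Icc (0:ℝ) 1 := Ioc_subset_Icc_self hx
    rcases eq_or_lt_of_le hi with rfl | hi
    · refine ((hA₂ x hx').trans (le_max_right _ _)).trans (le_mul_of_one_le_right hA ?_)
      exact one_le_rpow_of_pos_of_le_one_of_nonpos hx.1 hx.2 (by linarith)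
    · have := norm_le_mul_pow_of_hasDerivWithinAt (F := F) (k := k) (M := A)
        (fun i hi => hFd i (by omega)) hf0 (fun x hx => (hA₁ x hx).trans (le_max_left _ _))
        (k + 1 - i) i (by omega) x hx'
      refine this.trans (le_of_eq ?_)
      rw [← rpow_natCast, Nat.cast_sub (by omega), hN]
      push_cast
      congr 2
      ring
  have hHb : ∃ B : ℝ, 0 ≤ B ∧ ∀ n ≤ N, ∀ z > (0:ℝ), ‖H n z‖ ≤ B * z ^ (-((n:ℝ) + 1 / 2)) := by
    choose! C hC0 hC1 hC2 using hdecay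
    have hsup : ∀ n ≤ N, C n ≤ ∑ m ∈ Finset.range (N + 1), C m := fun n hn =>
      Finset.single_le_sum (f := C)
        (fun m hm => (hC0 m (by have := Finset.mem_range.1 hm; omega)).le)
        (Finset.mem_range.2 (by omega))
    set S := ∑ m ∈ Finset.range (N + 1), C m
    have hS : 0 ≤ S := (hC0 0 (by omega)).le.trans (hsup 0 (by omega))
    refine ⟨S * 2, by positivity, fun n hn z hz => ?_⟩
    have hp : 0 ≤ z ^ (-((n:ℝ) + 1 / 2)) := (rpow_pos_of_pos hz _).le
    have hCn := (hC0 n hn).le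
    rcases le_total z 1 with h | h
    · refine (hC1 n hn z ⟨hz, h⟩).trans ?_
      rw [mul_assoc]
      exact mul_le_mul (hsup n hn) (max_one_add_log_rpow_le n ⟨hz, h⟩)
        (le_max_of_le_right (rpow_pos_of_pos hz _).le) hS
    · refine (hC2 n hn z h).trans (mul_le_mul_of_nonneg_right ?_ hp)
      linarith [hsup n hn]
  obtain ⟨B, hB, hHb⟩ := hHb
  have hb : 0 < |β + 1| := abs_pos.2 fun h => hβ (by linarith)
  obtain ⟨K, hK, key⟩ := exists_norm_integral_mul_mul_cexp_le N hb (mul_nonneg hA hB) N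
  refine ⟨A * B + K + 1, by positivity, 1, le_rfl, fun ω hω => ?_⟩
  have hω0 : 0 < ω := by linarith
  have hc0 : 0 < ω⁻¹ := inv_pos.2 hω0
  have hc1 : ω⁻¹ ≤ 1 := inv_le_one_of_one_le₀ hω
  have hsub : Icc ω⁻¹ 1 ⊆ Icc (0:ℝ) 1 := Icc_subset_Icc_left hc0.le
  set P : ℕ → ℝ → ℂ := fun n x => (ω:ℂ) ^ n * H n (ω * x) with hPdef
  have hmaps : MapsTo (fun x : ℝ => ω * x) (Ioi 0) (Ioi 0) := fun x hx => mul_pos hω0 hx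
  have hPc : ∀ n ≤ N, ContinuousOn (P n) (Ioi 0) := fun n hn =>
    continuousOn_const.mul ((hHc n hn).comp (by fun_prop) hmaps)
  have hPd : ∀ n < N, ∀ x ∈ Ioi (0:ℝ), HasDerivAt (P n) (P (n + 1) x) x := by
    intro n hn x hx
    have h1 : HasDerivAt (fun x : ℝ => ω * x) ω x := by
      simpa using (hasDerivAt_id x).const_mul ω
    have h2 := ((hHd n hn (ω * x) (hmaps hx)).scomp x h1).const_mul ((ω:ℂ) ^ n)
    refine h2.congr_deriv ?_
    simp only [hPdef, Complex.real_smul]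
    ring
  have hPb : ∀ n ≤ N, ∀ x ∈ Ioi (0:ℝ),
      ‖P n x‖ ≤ B * ω ^ (-(1 / 2) : ℝ) * x ^ (-((n:ℝ) + 1 / 2)) := by
    intro n hn x hx
    have hx0 : 0 < x := hx
    simp only [hPdef, norm_mul, norm_pow, Complex.norm_real, Real.norm_eq_abs, abs_of_pos hω0]
    refine (mul_le_mul_of_nonneg_left (hHb n hn (ω * x) (hmaps hx)) (by positivity)).trans
      (le_of_eq ?_)
    have e : ω ^ (-(1 / 2) : ℝ) = ω ^ n * ω ^ (-((n:ℝ) + 1 / 2)) := by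
      rw [← rpow_natCast, ← rpow_add hω0]; congr 1; ring
    rw [mul_rpow hω0.le hx0.le, e]
    ring
  have hFP : ∀ i p, i + p ≤ N → ∀ x ∈ Ioc (0:ℝ) 1,
      ‖F i x * P p x‖ ≤ A * B * ω ^ (-(1 / 2) : ℝ) * x ^ ((N : ℝ) - 3 / 2 - ((i : ℝ) + p)) := by
    intro i p hip x hx
    have hx0 : 0 < x := hx.1
    rw [norm_mul]
    refine (mul_le_mul (hFb i (by omega) x hx) (hPb p (by omega) x hx.1) (norm_nonneg _)
      (by positivity)).trans (le_of_eq ?_)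
    have e : x ^ ((N : ℝ) - 3 / 2 - ((i : ℝ) + p))
        = x ^ ((N:ℝ) - 1 - i) * x ^ (-((p:ℝ) + 1 / 2)) := by
      rw [← rpow_add hx0]; congr 1; ring
    rw [e]
    ring
  have hI := key ω hω (ω * (β + 1)) (by rw [abs_mul, abs_of_pos hω0]) F P
    (fun i hi x hx => (hFd i hi x (hsub hx)).mono hsub)
    (fun i hi x hx => (hPd i hi x (hc0.trans_le hx.1)).hasDerivWithinAt)
    (fun i hi => (hFc i hi).mono hsub)
    (fun i hi => (hPc i hi).mono fun x hx => hc0.trans_le hx.1)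
    (fun i p hip x hx => hFP i p hip x ⟨hc0.trans_le hx.1, hx.2⟩)
    (fun i hi => hf1 i (by omega)) 0 0 (by omega)
  set G : ℝ → ℂ := fun x =>
    F 0 x * P 0 x * Complex.exp (Complex.I * ((ω * (β + 1) * x : ℝ) : ℂ)) with hG
  have hGeq : (fun x : ℝ => f x * h₀ (ω * x) *
      Complex.exp (Complex.I * ((ω * (β + 1) * x : ℝ) : ℂ))) = G := by
    funext x
    simp [hG, hFdef, hPdef, hHdef]
  have hGn : ∀ x, ‖G x‖ = ‖F 0 x * P 0 x‖ := fun x => by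
    rw [hG, norm_mul, mul_comm Complex.I, Complex.norm_exp_ofReal_mul_I, mul_one]
  have hGb : ∀ c ∈ Ioc (0:ℝ) 1, ∀ x ∈ Ioc 0 c,
      ‖G x‖ ≤ A * B * ω ^ (-(1 / 2) : ℝ) * c ^ ((N:ℝ) - 3 / 2) := by
    intro c hc x hx
    rw [hGn]
    refine (hFP 0 0 (by omega) x ⟨hx.1, hx.2.trans hc.2⟩).trans ?_
    simp only [Nat.cast_zero, add_zero, sub_zero]
    refine mul_le_mul_of_nonneg_left (rpow_le_rpow hx.1.le hx.2 ?_) (by positivity)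
    rw [hN]; push_cast
    have : (0:ℝ) ≤ k := Nat.cast_nonneg k
    linarith
  have hGc : ContinuousOn G (Ioc 0 1) :=
    (((hFc 0 (by omega)).mono Ioc_subset_Icc_self).mul
      ((hPc 0 (by omega)).mono fun x hx => hx.1)).mul (by fun_prop)
  have hGi : IntegrableOn G (Ioc 0 1) volume :=
    Integrable.of_bound (hGc.aestronglyMeasurable measurableSet_Ioc) _
      ((ae_restrict_iff' measurableSet_Ioc).2
        (Filter.Eventually.of_forall (hGb 1 ⟨one_pos, le_rfl⟩)))
  have hG1 : IntervalIntegrable G volume 0 ω⁻¹ :=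
    (intervalIntegrable_iff_integrableOn_Ioc_of_le hc0.le).2
      (hGi.mono_set (Ioc_subset_Ioc_right hc1))
  have hG2 : IntervalIntegrable G volume ω⁻¹ 1 :=
    (intervalIntegrable_iff_integrableOn_Ioc_of_le hc1).2
      (hGi.mono_set (Ioc_subset_Ioc_left hc0.le))
  have hfirst : ‖∫ x in (0:ℝ)..ω⁻¹, G x‖ ≤ A * B * ω⁻¹ ^ N := by
    refine (intervalIntegral.norm_integral_le_of_norm_le_const (fun x hx => hGb ω⁻¹ ⟨hc0, hc1⟩ x
      (by rwa [uIoc_of_le hc0.le] at hx))).trans (le_of_eq ?_)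
    have e : ω ^ (-(1 / 2) : ℝ) = ω⁻¹ ^ (1 / 2 : ℝ) := by
      rw [inv_rpow hω0.le, ← rpow_neg hω0.le]
    rw [sub_zero, abs_of_pos hc0, e, mul_assoc, mul_assoc, ← rpow_add_one hc0.ne',
      ← rpow_add hc0, ← rpow_natCast]
    congr 2
    ring
  rw [hGeq, ← intervalIntegral.integral_add_adjacent_intervals hG1 hG2]
  have hpow : ω⁻¹ ^ N ≤ ω ^ (-((k:ℝ) + 2) + δ) := by
    rw [inv_pow, ← rpow_natCast, ← rpow_neg hω0.le]
    refine rpow_le_rpow_of_exponent_le hω ?_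
    rw [hN]; push_cast; linarith
  have hpos : 0 < ω⁻¹ ^ N := by positivity
  calc _ ≤ A * B * ω⁻¹ ^ N + K * ω⁻¹ ^ N := (norm_add_le _ _).trans (add_le_add hfirst hI)
    _ ≤ (A * B + K + 1) * ω⁻¹ ^ N := by linarith
    _ ≤ _ := mul_le_mul_of_nonneg_left hpow (by positivity)
end

section
/- Let s, ν be natural numbers with ν ≥ 1, let β ∈ ℝ with β ≠ −1, and let h₀ : (0,∞) → ℂ satisfy the Hankel-type decay bounds up to order s+2. Let f : [0,1] → ℂ be (s+2)-times continuously differentiable, and let p be a polynomial (of degree at most 2s+ν+1) satisfying p⁽ʲ⁾(0) = f⁽ʲ⁾(0) and p⁽ʲ⁾(1) = f⁽ʲ⁾(1) for j = 0,…,s, and p((cₙ+1)/2) = f((cₙ+1)/2) for n = 1,…,ν, where cₙ = cos(nπ/(ν+1)). Then for every δ > 0 there exist C > 0 and ω₀ ≥ 1 such that for all ω ≥ ω₀, |∫₀¹ (f(x) − p(x)) h₀(ωx) e^{iω(β+1)x} dx| ≤ C ω^{−(s+2)+δ}. -/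
open MeasureTheory Real Set

theorem ContDiffOn.iteratedDerivWithin_eq_of_subset {F : Type*} [NormedAddCommGroup F]
    [NormedSpace ℝ F] {f : ℝ → F} {S T : Set ℝ} {n : ℕ} (hf : ContDiffOn ℝ n f T) (hST : S ⊆ T)
    (hS : UniqueDiffOn ℝ S) (hT : UniqueDiffOn ℝ T) {x : ℝ} (hx : x ∈ S) :
    iteratedDerivWithin n f S x = iteratedDerivWithin n f T x := by
  simp only [iteratedDerivWithin, iteratedFDerivWithin_subset hST hS hT hf hx]

theorem ContDiffOn.hasDerivWithinAt_iteratedDerivWithin_s3 {F : Type*} [NormedAddCommGroup F]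
    [NormedSpace ℝ F] {f : ℝ → F} {S : Set ℝ} {n k : ℕ} (hf : ContDiffOn ℝ n f S)
    (hS : UniqueDiffOn ℝ S) (hk : k < n) {x : ℝ} (hx : x ∈ S) :
    HasDerivWithinAt (iteratedDerivWithin k f S) (iteratedDerivWithin (k + 1) f S x) S x := by
  rw [iteratedDerivWithin_succ]
  exact (hf.differentiableOn_iteratedDerivWithin (by exact_mod_cast hk) hS x hx).hasDerivWithinAt

theorem Polynomial.contDiff_eval_ofReal (p : Polynomial ℂ) {n : ℕ} :
    ContDiff ℝ n (fun x : ℝ => p.eval (x : ℂ)) :=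
  (p.contDiff_aeval (𝕜 := ℂ) (n := n)).restrict_scalars ℝ |>.comp Complex.ofRealCLM.contDiff

theorem Polynomial.iteratedDerivWithin_eval_ofReal {S : Set ℝ} (hS : UniqueDiffOn ℝ S) (k : ℕ)
    (p : Polynomial ℂ) {x : ℝ} (hx : x ∈ S) :
    iteratedDerivWithin k (fun x : ℝ => p.eval (x : ℂ)) S x
      = (Polynomial.derivative^[k] p).eval (x : ℂ) := by
  induction k generalizing p x with
  | zero => simp
  | succ k ih =>
    rw [iteratedDerivWithin_succ', Function.iterate_succ_apply, ← ih _ hx]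
    refine iteratedDerivWithin_congr (fun y hy => ?_) hx
    exact ((p.hasDerivAt (y : ℂ)).comp_ofReal.hasDerivWithinAt).derivWithin (hS y hy)

/-- If the derivatives of `g` up to order `s` vanish at `0`, then on `(0,1]` its `m`-th derivative
is bounded by a multiple of `x ^ (s + 1 - m)`. -/
theorem exists_norm_iteratedDerivWithin_le_rpow {s : ℕ} {g : ℝ → ℂ}
    (hg : ContDiffOn ℝ (s + 2 : ℕ) g (Icc 0 1))
    (hg0 : ∀ j ≤ s, iteratedDerivWithin j g (Icc 0 1) 0 = 0) :
    ∃ M > (0 : ℝ), ∀ m ≤ s + 2, ∀ x ∈ Ioc (0 : ℝ) 1,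
      ‖iteratedDerivWithin m g (Icc 0 1) x‖ ≤ M * x ^ ((s : ℝ) + 1 - m) := by
  have hU : UniqueDiffOn ℝ (Icc (0 : ℝ) 1) := uniqueDiffOn_Icc zero_lt_one
  have hbound (m : ℕ) (hm : m ≤ s + 2) :
      ∃ C, ∀ x ∈ Icc (0 : ℝ) 1, ‖iteratedDerivWithin m g (Icc 0 1) x‖ ≤ C :=
    isCompact_Icc.exists_bound_of_continuousOn
      (hg.continuousOn_iteratedDerivWithin (by exact_mod_cast hm) hU)
  obtain ⟨C₁, hC₁⟩ := hbound (s + 1) (by lia)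
  obtain ⟨C₂, hC₂⟩ := hbound (s + 2) le_rfl
  set M : ℝ := max 1 (max C₁ C₂)
  have hMpos : 0 < M := lt_of_lt_of_le one_pos (le_max_left _ _)
  have key : ∀ i ≤ s + 1, ∀ x ∈ Icc (0 : ℝ) 1,
      ‖iteratedDerivWithin (s + 1 - i) g (Icc 0 1) x‖ ≤ M * x ^ i := by
    intro i
    induction i with
    | zero =>
      intro _ x hx
      rw [pow_zero, mul_one]
      exact (hC₁ x hx).trans ((le_max_left _ _).trans (le_max_right _ _))
    | succ i ih =>
      intro hi x hx
      have hsucc : s + 1 - i = s + 1 - (i + 1) + 1 := by lia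
      have hsub : Icc 0 x ⊆ Icc (0 : ℝ) 1 := Icc_subset_Icc_right hx.2
      have hmv := (convex_Icc 0 x).norm_image_sub_le_of_norm_hasDerivWithin_le
        (f := iteratedDerivWithin (s + 1 - (i + 1)) g (Icc 0 1))
        (f' := iteratedDerivWithin (s + 1 - i) g (Icc 0 1)) (C := M * x ^ i)
        (fun y hy => by
          rw [hsucc]
          exact (hg.hasDerivWithinAt_iteratedDerivWithin_s3 hU (by lia) (hsub hy)).mono hsub)
        (fun y hy => (ih (by lia) y (hsub hy)).trans
          (mul_le_mul_of_nonneg_left (pow_le_pow_left₀ hy.1 hy.2 i) hMpos.le))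
        (left_mem_Icc.2 hx.1) (right_mem_Icc.2 hx.1)
      rw [hg0 _ (by lia), sub_zero, sub_zero, Real.norm_of_nonneg hx.1] at hmv
      rwa [pow_succ, ← mul_assoc]
  refine ⟨M, hMpos, fun m hm x hx => ?_⟩
  obtain hm' | rfl : m ≤ s + 1 ∨ m = s + 2 := by lia
  · have h := key (s + 1 - m) (by lia) x (Ioc_subset_Icc_self hx)
    rw [show s + 1 - (s + 1 - m) = m by lia, ← Real.rpow_natCast] at h
    rwa [Nat.cast_sub hm', Nat.cast_add, Nat.cast_one] at h
  · refine (hC₂ x (Ioc_subset_Icc_self hx)).trans (((le_max_right _ _).trans (le_max_right _ _)).trans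
      (le_mul_of_one_le_right hMpos.le (Real.one_le_rpow_of_pos_of_le_one_of_nonpos hx.1 hx.2 ?_)))
    push_cast
    linarith

theorem Real.one_add_log_one_div_le_two_mul_rpow {z : ℝ} (hz : 0 < z) :
    1 + Real.log (1 / z) ≤ 2 * z ^ (-(1 / 2) : ℝ) := by
  have h := Real.log_le_sub_one_of_pos (Real.rpow_pos_of_pos hz (-(1 / 2) : ℝ))
  rw [Real.log_rpow hz] at h
  rw [one_div, Real.log_inv]
  linarith

/-- The Hankel-type decay bounds give the uniform bound `z ^ (-(n + 1/2))` on all of `(0,∞)`. -/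
theorem exists_norm_le_rpow_of_hankel_bounds {N : ℕ} {h : ℕ → ℝ → ℂ}
    (hdecay : ∀ n : ℕ, n ≤ N → ∃ C > (0 : ℝ),
      (∀ z ∈ Ioc (0 : ℝ) 1, ‖h n z‖ ≤ C * max (1 + Real.log (1 / z)) (z ^ (-(n : ℝ)))) ∧
      (∀ z ∈ Ici (1 : ℝ), ‖h n z‖ ≤ C * z ^ (-((n : ℝ) + 1 / 2)))) :
    ∃ C > (0 : ℝ), ∀ n ≤ N, ∀ z : ℝ, 0 < z → ‖h n z‖ ≤ C * z ^ (-((n : ℝ) + 1 / 2)) := by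
  choose! C hCpos hC using hdecay
  have hsum_pos : 0 ≤ ∑ n ∈ Finset.range (N + 1), |C n| := Finset.sum_nonneg fun _ _ => abs_nonneg _
  refine ⟨2 * (1 + ∑ n ∈ Finset.range (N + 1), |C n|), by linarith, fun n hn z hz => ?_⟩
  have hCn : C n ≤ 1 + ∑ n ∈ Finset.range (N + 1), |C n| :=
    (le_abs_self _).trans ((Finset.single_le_sum (f := fun n => |C n|) (fun _ _ => abs_nonneg _)
      (Finset.mem_range.2 (Nat.lt_succ_of_le hn))).trans (le_add_of_nonneg_left zero_le_one))
  have hp : 0 < z ^ (-((n : ℝ) + 1 / 2)) := Real.rpow_pos_of_pos hz _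
  have hCn0 := (hCpos n hn).le
  suffices ‖h n z‖ ≤ 2 * C n * z ^ (-((n : ℝ) + 1 / 2)) from
    this.trans (mul_le_mul_of_nonneg_right (by linarith) hp.le)
  rcases le_total z 1 with hz1 | hz1
  · refine ((hC n hn).1 z ⟨hz, hz1⟩).trans ?_
    rw [mul_comm 2, mul_assoc]
    refine mul_le_mul_of_nonneg_left (max_le ?_ ?_) hCn0
    · refine (Real.one_add_log_one_div_le_two_mul_rpow hz).trans
        (mul_le_mul_of_nonneg_left (Real.rpow_le_rpow_of_exponent_ge hz hz1 ?_) two_pos.le)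
      have : (0 : ℝ) ≤ n := n.cast_nonneg
      linarith
    · have := Real.rpow_le_rpow_of_exponent_ge hz hz1
        (show -((n : ℝ) + 1 / 2) ≤ -(n : ℝ) by linarith)
      linarith
  · refine ((hC n hn).2 z hz1).trans (mul_le_mul_of_nonneg_right (by linarith) hp.le)

/-- Integration by parts against `e^{icx}`, with limits of the boundary terms. -/
theorem integral_mul_cexp_eq_of_tendsto {a b c : ℝ} (hab : a < b) (hc : c ≠ 0) {u u' : ℝ → ℂ}
    (hu : ∀ x ∈ Ioo a b, HasDerivAt u (u' x) x) (hui : IntervalIntegrable u volume a b)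
    (hui' : IntervalIntegrable u' volume a b) {ua ub : ℂ}
    (ha : Filter.Tendsto u (nhdsWithin a (Ioi a)) (nhds ua))
    (hb : Filter.Tendsto u (nhdsWithin b (Iio b)) (nhds ub)) :
    ∫ x in a..b, u x * Complex.exp (Complex.I * (c * x : ℝ))
      = (ub * Complex.exp (Complex.I * (c * b : ℝ)) - ua * Complex.exp (Complex.I * (c * a : ℝ))
          - ∫ x in a..b, u' x * Complex.exp (Complex.I * (c * x : ℝ))) / (Complex.I * c) := by
  have hIc : Complex.I * (c : ℂ) ≠ 0 := mul_ne_zero Complex.I_ne_zero (by exact_mod_cast hc)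
  have hE : Continuous fun x : ℝ => Complex.exp (Complex.I * (c * x : ℝ)) := by fun_prop
  have hE' (x : ℝ) : HasDerivAt (fun x : ℝ => Complex.exp (Complex.I * (c * x : ℝ)))
      (Complex.exp (Complex.I * (c * x : ℝ)) * (Complex.I * c)) x := by
    have h1 : HasDerivAt (fun x : ℝ => ((c * x : ℝ) : ℂ)) c x := by
      simpa using ((hasDerivAt_id x).const_mul c).ofReal_comp
    exact (h1.const_mul Complex.I).cexp
  have hi := hui.mul_continuousOn (hE.continuousOn (s := uIcc a b))
  have hi' := hui'.mul_continuousOn (hE.continuousOn (s := uIcc a b))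
  have hftc := intervalIntegral.integral_eq_sub_of_hasDerivAt_of_tendsto hab
    (f := fun x => u x * Complex.exp (Complex.I * (c * x : ℝ)))
    (f' := fun x => u' x * Complex.exp (Complex.I * (c * x : ℝ))
      + u x * Complex.exp (Complex.I * (c * x : ℝ)) * (Complex.I * c))
    (fun x hx => by rw [mul_assoc]; exact (hu x hx).mul (hE' x))
    (hi'.add (hi.mul_const _))
    (ha.mul (hE.continuousAt.tendsto.mono_left nhdsWithin_le_nhds))
    (hb.mul (hE.continuousAt.tendsto.mono_left nhdsWithin_le_nhds))
  rw [intervalIntegral.integral_add hi' (hi.mul_const _),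
    intervalIntegral.integral_mul_const] at hftc
  rw [eq_div_iff hIc, ← hftc]
  ring

theorem norm_mul_cexp_I_mul_ofReal (w : ℂ) (t : ℝ) :
    ‖w * Complex.exp (Complex.I * (t : ℝ))‖ = ‖w‖ := by
  rw [norm_mul, mul_comm Complex.I, Complex.norm_exp_ofReal_mul_I, mul_one]

theorem intervalIntegrable_zero_one_of_norm_le_rpow {u : ℝ → ℂ} (hu : ContinuousOn u (Ioc 0 1))
    {A r : ℝ} (hr : -1 < r) (hbd : ∀ x ∈ Ioc (0 : ℝ) 1, ‖u x‖ ≤ A * x ^ r) :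
    IntervalIntegrable u volume 0 1 := by
  have h := (intervalIntegral.intervalIntegrable_rpow' (a := 0) (b := 1) hr).const_mul A
  rw [intervalIntegrable_iff_integrableOn_Ioc_of_le zero_le_one] at h ⊢
  refine h.mono' (hu.aestronglyMeasurable measurableSet_Ioc) ?_
  filter_upwards [ae_restrict_mem measurableSet_Ioc] with x hx using hbd x hx

theorem norm_integral_mul_cexp_le_of_rpow_bound {c a A : ℝ} (hc : c ≠ 0) (ha : 0 < a) (ha1 : a < 1)
    {u u' : ℝ → ℂ} (hu : ContinuousOn u (Ioc 0 1)) (hu' : ContinuousOn u' (Ioc 0 1))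
    (hder : ∀ x ∈ Ioo (0 : ℝ) 1, HasDerivAt u (u' x) x)
    (hbd : ∀ x ∈ Ioc (0 : ℝ) 1, ‖u x‖ ≤ A * x ^ (-(1 / 2) : ℝ))
    (hbd' : ∀ x ∈ Ioc (0 : ℝ) 1, ‖u' x‖ ≤ A * x ^ (-(3 / 2) : ℝ)) :
    ‖∫ x in (0 : ℝ)..1, u x * Complex.exp (Complex.I * (c * x : ℝ))‖
      ≤ 2 * A * a ^ (1 / 2 : ℝ) + 4 * A * a ^ (-(1 / 2) : ℝ) / |c| := by
  have hA : 0 ≤ A := by simpa using (norm_nonneg _).trans (hbd 1 ⟨one_pos, le_rfl⟩)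
  have hE : Continuous fun x : ℝ => Complex.exp (Complex.I * (c * x : ℝ)) := by fun_prop
  have hi : IntervalIntegrable u volume 0 1 :=
    intervalIntegrable_zero_one_of_norm_le_rpow hu (by norm_num) hbd
  have hsub : Icc a 1 ⊆ Ioc 0 1 := fun x hx => ⟨ha.trans_le hx.1, hx.2⟩
  have hsub_uIcc : uIcc a 1 ⊆ Ioc 0 1 := by rwa [uIcc_of_le ha1.le]
  have hi0 : IntervalIntegrable u volume 0 a := hi.mono_set (by
    rw [uIcc_of_le ha.le, uIcc_of_le zero_le_one]; exact Icc_subset_Icc_right ha1.le)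
  have hi1 : IntervalIntegrable u volume a 1 := (hu.mono hsub_uIcc).intervalIntegrable
  have hi1' : IntervalIntegrable u' volume a 1 := (hu'.mono hsub_uIcc).intervalIntegrable
  rw [← intervalIntegral.integral_add_adjacent_intervals
    (hi0.mul_continuousOn hE.continuousOn) (hi1.mul_continuousOn hE.continuousOn)]
  have hhead : ‖∫ x in (0 : ℝ)..a, u x * Complex.exp (Complex.I * (c * x : ℝ))‖
      ≤ 2 * A * a ^ (1 / 2 : ℝ) := by
    refine (intervalIntegral.norm_integral_le_of_norm_le ha.le
      (g := fun x => A * x ^ (-(1 / 2) : ℝ)) (ae_of_all _ fun x hx => ?_)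
      ((intervalIntegral.intervalIntegrable_rpow' (by norm_num)).const_mul A)).trans_eq ?_
    · rw [norm_mul_cexp_I_mul_ofReal]
      exact hbd x ⟨hx.1, hx.2.trans ha1.le⟩
    · rw [intervalIntegral.integral_const_mul, integral_rpow (Or.inl (by norm_num)),
        Real.zero_rpow (by norm_num)]
      norm_num
      ring
  have hapow : (1 : ℝ) ≤ a ^ (-(1 / 2) : ℝ) :=
    Real.one_le_rpow_of_pos_of_le_one_of_nonpos ha ha1.le (by norm_num)
  have htail' : ‖∫ x in a..1, u' x * Complex.exp (Complex.I * (c * x : ℝ))‖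
      ≤ 2 * A * a ^ (-(1 / 2) : ℝ) := by
    have h0 : (0 : ℝ) ∉ uIcc a 1 := fun h => (hsub_uIcc h).1.false
    refine (intervalIntegral.norm_integral_le_of_norm_le ha1.le
      (g := fun x => A * x ^ (-(3 / 2) : ℝ)) (ae_of_all _ fun x hx => ?_)
      ((intervalIntegral.intervalIntegrable_rpow (Or.inr h0)).const_mul A)).trans ?_
    · rw [norm_mul_cexp_I_mul_ofReal]
      exact hbd' x (hsub (Ioc_subset_Icc_self hx))
    · rw [intervalIntegral.integral_const_mul, integral_rpow (Or.inr ⟨by norm_num, h0⟩)]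
      norm_num
      nlinarith
  have htail : ‖∫ x in a..1, u x * Complex.exp (Complex.I * (c * x : ℝ))‖
      ≤ 4 * A * a ^ (-(1 / 2) : ℝ) / |c| := by
    have hder1 : ∀ x ∈ Ioo a 1, HasDerivAt u (u' x) x :=
      fun x hx => hder x ⟨ha.trans hx.1, hx.2⟩
    rw [integral_mul_cexp_eq_of_tendsto ha1 hc hder1 hi1 hi1'
      (hder a ⟨ha, ha1⟩).continuousAt.continuousWithinAt.tendsto
      ((hu 1 ⟨one_pos, le_rfl⟩).mono_of_mem_nhdsWithin (Ioc_mem_nhdsLT one_pos)).tendsto,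
      norm_div, norm_mul Complex.I, Complex.norm_I, one_mul, Complex.norm_real, Real.norm_eq_abs]
    gcongr
    refine (norm_sub_le _ _).trans ((add_le_add ((norm_sub_le _ _).trans (add_le_add
      (norm_mul_cexp_I_mul_ofReal _ _).le (norm_mul_cexp_I_mul_ofReal _ _).le)) htail').trans ?_)
    have h1 := hbd 1 ⟨one_pos, le_rfl⟩
    have h2 := hbd a ⟨ha, ha1.le⟩
    rw [Real.one_rpow, mul_one] at h1
    nlinarith
  exact (norm_add_le _ _).trans (add_le_add hhead htail)

/-- `k` integrations by parts without boundary contributions. -/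
theorem norm_integral_mul_cexp_eq_div_pow {s : ℕ} {c A : ℝ} (hc : c ≠ 0) {G : ℕ → ℝ → ℂ}
    (hcont : ∀ k ≤ s + 1, ContinuousOn (G k) (Ioc 0 1))
    (hder : ∀ k ≤ s, ∀ x ∈ Ioo (0 : ℝ) 1, HasDerivAt (G k) (G (k + 1) x) x)
    (hbd : ∀ k ≤ s + 1, ∀ x ∈ Ioc (0 : ℝ) 1, ‖G k x‖ ≤ A * x ^ ((s : ℝ) + 1 / 2 - k))
    (hone : ∀ k ≤ s, G k 1 = 0) {k : ℕ} (hk : k ≤ s + 1) :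
    ‖∫ x in (0 : ℝ)..1, G 0 x * Complex.exp (Complex.I * (c * x : ℝ))‖
      = ‖∫ x in (0 : ℝ)..1, G k x * Complex.exp (Complex.I * (c * x : ℝ))‖ / |c| ^ k := by
  have hint (k : ℕ) (hk : k ≤ s + 1) : IntervalIntegrable (G k) volume 0 1 := by
    refine intervalIntegrable_zero_one_of_norm_le_rpow (hcont k hk) ?_ (hbd k hk)
    have : (k : ℝ) ≤ s + 1 := by exact_mod_cast hk
    linarith
  induction k with
  | zero => simp
  | succ k ih =>
    have hks : (k : ℝ) ≤ s := by exact_mod_cast (show k ≤ s by lia)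
    have hzero : Filter.Tendsto (G k) (nhdsWithin 0 (Ioi 0)) (nhds 0) := by
      have hp : (0 : ℝ) < s + 1 / 2 - k := by linarith
      have hlim : Filter.Tendsto (fun x : ℝ => A * x ^ ((s : ℝ) + 1 / 2 - k))
          (nhdsWithin 0 (Ioi 0)) (nhds 0) := by
        have h := ((Real.continuous_rpow_const hp.le).tendsto 0).const_mul A
        rw [Real.zero_rpow hp.ne', mul_zero] at h
        exact h.mono_left nhdsWithin_le_nhds
      refine squeeze_zero_norm' ?_ hlim
      filter_upwards [Ioc_mem_nhdsGT zero_lt_one] with x hx using hbd k (by lia) x hx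
    have hend : Filter.Tendsto (G k) (nhdsWithin 1 (Iio 1)) (nhds 0) := by
      rw [← hone k (by lia)]
      exact ((hcont k (by lia) 1 ⟨one_pos, le_rfl⟩).mono_of_mem_nhdsWithin
        (Ioc_mem_nhdsLT one_pos)).tendsto
    rw [ih (by lia), integral_mul_cexp_eq_of_tendsto one_pos hc (hder k (by lia))
      (hint k (by lia)) (hint (k + 1) hk) hzero hend, zero_mul, zero_mul, sub_zero, zero_sub,
      norm_div, norm_neg, norm_mul Complex.I, Complex.norm_I, one_mul, Complex.norm_real,
      Real.norm_eq_abs, div_div, pow_succ']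

theorem norm_iteratedDerivWithin_mul_le {S : Set ℝ} (hS : UniqueDiffOn ℝ S) {g h : ℝ → ℂ} {n : ℕ}
    (hg : ContDiffOn ℝ n g S) (hh : ContDiffOn ℝ n h S) {x : ℝ} (hx : x ∈ S) :
    ‖iteratedDerivWithin n (fun y => g y * h y) S x‖ ≤ ∑ i ∈ Finset.range (n + 1),
      (n.choose i : ℝ) * ‖iteratedDerivWithin i g S x‖ * ‖iteratedDerivWithin (n - i) h S x‖ := by
  simpa only [norm_iteratedFDerivWithin_eq_norm_iteratedDerivWithin] using
    norm_iteratedFDerivWithin_mul_le (N := n) hg hh hS hx le_rfl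

theorem norm_iteratedDerivWithin_comp_const_mul_le {N : ℕ} {h : ℝ → ℂ} {C ω : ℝ} (hω : 0 < ω)
    (hsmooth : ContDiffOn ℝ N h (Ioi 0))
    (hbd : ∀ n ≤ N, ∀ z : ℝ, 0 < z →
      ‖iteratedDerivWithin n h (Ioi 0) z‖ ≤ C * z ^ (-((n : ℝ) + 1 / 2)))
    {n : ℕ} (hn : n ≤ N) {x : ℝ} (hx : x ∈ Ioc (0 : ℝ) 1) :
    ‖iteratedDerivWithin n (fun y => h (ω * y)) (Ioc 0 1) x‖
      ≤ C * ω ^ (-(1 / 2) : ℝ) * x ^ (-((n : ℝ) + 1 / 2)) := by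
  have hmaps : MapsTo (fun y => ω * y) (Ioi 0) (Ioi 0) := fun y hy => mul_pos hω hy
  have hn' : ContDiffOn ℝ n h (Ioi 0) := hsmooth.of_le (by exact_mod_cast hn)
  have hcomp : ContDiffOn ℝ n (fun y => h (ω * y)) (Ioi 0) :=
    hn'.comp (by fun_prop) hmaps
  rw [hcomp.iteratedDerivWithin_eq_of_subset (fun y hy => hy.1) (uniqueDiffOn_Ioc 0 1)
    (uniqueDiffOn_Ioi 0) hx, iteratedDerivWithin_comp_const_smul (mem_Ioi.2 hx.1) (uniqueDiffOn_Ioi 0) hn' ω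
    hmaps, norm_smul, Real.norm_of_nonneg (pow_nonneg hω.le n)]
  refine (mul_le_mul_of_nonneg_left (hbd n hn _ (mul_pos hω hx.1)) (pow_nonneg hω.le n)).trans_eq ?_
  rw [Real.mul_rpow hω.le hx.1.le, neg_add, Real.rpow_add hω, Real.rpow_neg hω.le (n : ℝ),
    Real.rpow_natCast]
  field_simp

/-- The oscillatory integral of an amplitude vanishing to order `s` at both endpoints, against a
kernel with derivatives bounded by `z ^ (-(n + 1/2))`, decays like `ω ^ (-(s + 2))`. -/
theorem exists_norm_integral_mul_cexp_le {s : ℕ} {κ : ℝ} (hκ : κ ≠ 0) {g h : ℝ → ℂ} {C : ℝ}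
    (hC : 0 < C) (hsmooth : ContDiffOn ℝ (s + 2 : ℕ) h (Ioi 0))
    (hbd : ∀ n ≤ s + 2, ∀ z : ℝ, 0 < z →
      ‖iteratedDerivWithin n h (Ioi 0) z‖ ≤ C * z ^ (-((n : ℝ) + 1 / 2)))
    (hg : ContDiffOn ℝ (s + 2 : ℕ) g (Icc 0 1))
    (hg0 : ∀ j ≤ s, iteratedDerivWithin j g (Icc 0 1) 0 = 0)
    (hg1 : ∀ j ≤ s, iteratedDerivWithin j g (Icc 0 1) 1 = 0) :
    ∃ K > (0 : ℝ), ∀ ω : ℝ, 1 < ω →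
      ‖∫ x in (0 : ℝ)..1, g x * h (ω * x) * Complex.exp (Complex.I * (ω * κ * x : ℝ))‖
        ≤ K * ω ^ (-((s : ℝ) + 2)) := by
  obtain ⟨M, hM, hgM⟩ := exists_norm_iteratedDerivWithin_le_rpow hg hg0
  have hU : UniqueDiffOn ℝ (Ioc (0 : ℝ) 1) := uniqueDiffOn_Ioc 0 1
  have hgeq {k : ℕ} (hk : k ≤ s + 2) {x : ℝ} (hx : x ∈ Ioc (0 : ℝ) 1) :
      iteratedDerivWithin k g (Ioc 0 1) x = iteratedDerivWithin k g (Icc 0 1) x :=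
    (hg.of_le (by exact_mod_cast hk)).iteratedDerivWithin_eq_of_subset Ioc_subset_Icc_self hU
      (uniqueDiffOn_Icc zero_lt_one) hx
  set B : ℝ := 2 ^ (s + 2) * (M * C) with hB
  have hBpos : 0 < B := by positivity
  have hκ' : 0 < |κ| := abs_pos.2 hκ
  refine ⟨(2 * B + 4 * B / |κ|) / |κ| ^ (s + 1), by positivity, fun ω hω1 => ?_⟩
  have hω : 0 < ω := one_pos.trans hω1
  have hgU : ContDiffOn ℝ (s + 2 : ℕ) g (Ioc 0 1) := hg.mono Ioc_subset_Icc_self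
  have hhU : ContDiffOn ℝ (s + 2 : ℕ) (fun y => h (ω * y)) (Ioc 0 1) :=
    hsmooth.comp (by fun_prop) fun y hy => mul_pos hω hy.1
  have hleib {k : ℕ} (hk : k ≤ s + 2) {x : ℝ} (hx : x ∈ Ioc (0 : ℝ) 1) :=
    norm_iteratedDerivWithin_mul_le hU (hgU.of_le (by exact_mod_cast hk))
      (hhU.of_le (m := (k : ℕ)) (by exact_mod_cast hk)) hx
  set G : ℕ → ℝ → ℂ := fun k => iteratedDerivWithin k (fun y => g y * h (ω * y)) (Ioc 0 1)
    with hG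
  have hcont (k : ℕ) (hk : k ≤ s + 2) : ContinuousOn (G k) (Ioc 0 1) :=
    (hgU.mul hhU).continuousOn_iteratedDerivWithin (by exact_mod_cast hk) hU
  have hder (k : ℕ) (hk : k ≤ s + 1) (x : ℝ) (hx : x ∈ Ioo (0 : ℝ) 1) :
      HasDerivAt (G k) (G (k + 1) x) x :=
    ((hgU.mul hhU).hasDerivWithinAt_iteratedDerivWithin_s3 hU (by lia)
      (Ioo_subset_Ioc_self hx)).hasDerivAt (Ioc_mem_nhds hx.1 hx.2)
  have hGbd (k : ℕ) (hk : k ≤ s + 2) (x : ℝ) (hx : x ∈ Ioc (0 : ℝ) 1) :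
      ‖G k x‖ ≤ B * ω ^ (-(1 / 2) : ℝ) * x ^ ((s : ℝ) + 1 / 2 - k) := by
    have hpos : 0 < ω ^ (-(1 / 2) : ℝ) * x ^ ((s : ℝ) + 1 / 2 - k) :=
      mul_pos (Real.rpow_pos_of_pos hω _) (Real.rpow_pos_of_pos hx.1 _)
    calc ‖G k x‖ ≤ _ := hleib hk hx
      _ ≤ ∑ i ∈ Finset.range (k + 1), (k.choose i : ℝ) *
          (M * C * (ω ^ (-(1 / 2) : ℝ) * x ^ ((s : ℝ) + 1 / 2 - k))) := by
        refine Finset.sum_le_sum fun i hi => ?_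
        have hik : i ≤ k := Nat.lt_succ_iff.1 (Finset.mem_range.1 hi)
        rw [mul_assoc, hgeq (hik.trans hk) hx]
        refine mul_le_mul_of_nonneg_left ?_ (Nat.cast_nonneg _)
        refine (mul_le_mul (hgM i (hik.trans hk) x hx)
          (norm_iteratedDerivWithin_comp_const_mul_le hω hsmooth hbd (by lia) hx) (norm_nonneg _)
          (mul_nonneg hM.le (Real.rpow_nonneg hx.1.le _))).trans_eq ?_
        rw [show (s : ℝ) + 1 / 2 - k = ((s : ℝ) + 1 - i) + -(((k - i : ℕ) : ℝ) + 1 / 2) by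
          rw [Nat.cast_sub hik]; ring, Real.rpow_add hx.1]
        ring
      _ = 2 ^ k * (M * C * (ω ^ (-(1 / 2) : ℝ) * x ^ ((s : ℝ) + 1 / 2 - k))) := by
        rw [← Finset.sum_mul, ← Nat.cast_sum, Nat.sum_range_choose]
        push_cast
        rfl
      _ ≤ 2 ^ (s + 2) * (M * C * (ω ^ (-(1 / 2) : ℝ) * x ^ ((s : ℝ) + 1 / 2 - k))) := by
        gcongr
        exact one_le_two
      _ = _ := by rw [hB]; ring
  have hone (k : ℕ) (hk : k ≤ s) : G k 1 = 0 := by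
    refine norm_le_zero_iff.1 ((hleib (by lia) ⟨one_pos, le_rfl⟩).trans_eq
      (Finset.sum_eq_zero fun i hi => ?_))
    have hik : i ≤ k := Nat.lt_succ_iff.1 (Finset.mem_range.1 hi)
    rw [hgeq (by lia) ⟨one_pos, le_rfl⟩, hg1 i (hik.trans hk), norm_zero, mul_zero, zero_mul]
  have hc : ω * κ ≠ 0 := mul_ne_zero hω.ne' hκ
  have hibp := norm_integral_mul_cexp_eq_div_pow hc (fun k hk => hcont k (by lia))
    (fun k hk => hder k (by lia)) (fun k hk => hGbd k (by lia)) hone le_rfl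
  have hlast := norm_integral_mul_cexp_le_of_rpow_bound (a := ω⁻¹)
    (A := B * ω ^ (-(1 / 2) : ℝ)) hc (inv_pos.2 hω)
    (inv_lt_one_of_one_lt₀ hω1) (hcont (s + 1) (by lia)) (hcont (s + 2) le_rfl) (hder (s + 1) le_rfl)
    (fun x hx => (hGbd (s + 1) (by lia) x hx).trans_eq (by push_cast; ring_nf))
    (fun x hx => (hGbd (s + 2) le_rfl x hx).trans_eq (by push_cast; ring_nf))
  simp only [hG, iteratedDerivWithin_zero] at hibp
  rw [hibp]
  refine (div_le_div_of_nonneg_right hlast (by positivity)).trans_eq ?_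
  have hhalf : ω ^ (-(1 / 2) : ℝ) * ω ^ (-(1 / 2) : ℝ) = ω⁻¹ := by
    rw [← Real.rpow_add hω, ← Real.rpow_neg_one]
    norm_num
  have hhalf' : ω ^ (-(1 / 2) : ℝ) * ω ^ (1 / 2 : ℝ) = 1 := by
    rw [← Real.rpow_add hω]
    norm_num
  have hs : ω ^ (-((s : ℝ) + 2)) = (ω ^ (s + 2))⁻¹ := by
    rw [Real.rpow_neg hω.le, ← Real.rpow_natCast]
    push_cast
    rfl
  rw [Real.inv_rpow hω.le, Real.inv_rpow hω.le, ← Real.rpow_neg hω.le, ← Real.rpow_neg hω.le,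
    neg_neg, hs, abs_mul, abs_of_pos hω, mul_pow]
  calc _ = (2 * B * (ω ^ (-(1 / 2) : ℝ) * ω ^ (-(1 / 2) : ℝ))
        + 4 * B * (ω ^ (-(1 / 2) : ℝ) * ω ^ (1 / 2 : ℝ)) / (ω * |κ|))
        / (ω ^ (s + 1) * |κ| ^ (s + 1)) := by ring
    _ = _ := by
      rw [hhalf, hhalf']
      field_simp
      ring

/-- **Asymptotic error of the extended Filon method for the first Hankel-kernel integral**:
`Q⁽¹⁾_{[s,ν]}[f] − I⁽¹⁾_{ω,β}[f] = O_δ(ω^{−(s+2)+δ})`. Here `p` is the extended Filon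
interpolant matching `f` and its first `s` derivatives at the endpoints `0, 1` and matching
`f` at the interior (shifted) Clenshaw–Curtis points `(cos(nπ/(ν+1)) + 1)/2`. -/
theorem extended_filon_error_first_kind (s ν : ℕ) (hν : 1 ≤ ν) (β : ℝ) (hβ : β ≠ -1)
    (h₀ : ℝ → ℂ)
    (hsmooth : ContDiffOn ℝ (s + 2 : ℕ) h₀ (Ioi 0))
    (hdecay : ∀ n : ℕ, n ≤ s + 2 → ∃ C > (0:ℝ),
      (∀ z ∈ Ioc (0:ℝ) 1,
        ‖iteratedDerivWithin n h₀ (Ioi 0) z‖ ≤ C * max (1 + Real.log (1 / z)) (z ^ (-(n:ℝ)))) ∧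
      (∀ z ∈ Ici (1:ℝ),
        ‖iteratedDerivWithin n h₀ (Ioi 0) z‖ ≤ C * z ^ (-((n:ℝ) + 1 / 2))))
    (f : ℝ → ℂ) (hf : ContDiffOn ℝ (s + 2 : ℕ) f (Icc 0 1))
    (p : Polynomial ℂ) (hdeg : p.natDegree ≤ 2 * s + ν + 1)
    (hp0 : ∀ j ≤ s, (Polynomial.derivative^[j] p).eval (0:ℂ) = iteratedDerivWithin j f (Icc 0 1) 0)
    (hp1 : ∀ j ≤ s, (Polynomial.derivative^[j] p).eval (1:ℂ) = iteratedDerivWithin j f (Icc 0 1) 1)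
    (hpcc : ∀ n : ℕ, 1 ≤ n → n ≤ ν →
      p.eval ((((Real.cos ((n : ℝ) * π / ((ν : ℝ) + 1)) + 1) / 2 : ℝ)) : ℂ)
        = f ((Real.cos ((n : ℝ) * π / ((ν : ℝ) + 1)) + 1) / 2))
    (δ : ℝ) (hδ : 0 < δ) :
    ∃ C > (0:ℝ), ∃ ω₀ : ℝ, 1 ≤ ω₀ ∧ ∀ ω : ℝ, ω₀ ≤ ω →
      ‖∫ x in (0:ℝ)..1,
          (f x - p.eval ((x : ℝ) : ℂ)) * h₀ (ω * x)
            * Complex.exp (Complex.I * ((ω * (β + 1) * x : ℝ) : ℂ))‖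
        ≤ C * ω ^ (-((s:ℝ) + 2) + δ) := by
  have hU : UniqueDiffOn ℝ (Icc (0 : ℝ) 1) := uniqueDiffOn_Icc zero_lt_one
  have hpsmooth (n : ℕ) : ContDiffOn ℝ n (fun x : ℝ => p.eval (x : ℂ)) (Icc 0 1) :=
    p.contDiff_eval_ofReal.contDiffOn
  have hsub (j : ℕ) (hj : j ≤ s) {x : ℝ} (hx : x ∈ Icc (0 : ℝ) 1) :
      iteratedDerivWithin j (fun x : ℝ => f x - p.eval (x : ℂ)) (Icc 0 1) x
        = iteratedDerivWithin j f (Icc 0 1) x - (Polynomial.derivative^[j] p).eval (x : ℂ) := by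
    rw [← Polynomial.iteratedDerivWithin_eval_ofReal hU j p hx]
    exact iteratedDerivWithin_sub hx hU
      ((hf.of_le (by exact_mod_cast (by lia : j ≤ s + 2))) x hx) (hpsmooth j x hx)
  obtain ⟨C, hC, hbd⟩ := exists_norm_le_rpow_of_hankel_bounds hdecay
  obtain ⟨K, hK, hint⟩ := exists_norm_integral_mul_cexp_le (κ := β + 1)
    (fun h => hβ (eq_neg_of_add_eq_zero_left h)) hC hsmooth hbd (hf.sub (hpsmooth _))
    (fun j hj => by
      rw [hsub j hj (left_mem_Icc.2 zero_le_one), Complex.ofReal_zero, hp0 j hj, sub_self])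
    (fun j hj => by
      rw [hsub j hj (right_mem_Icc.2 zero_le_one), Complex.ofReal_one, hp1 j hj, sub_self])
  refine ⟨K, hK, 2, one_le_two, fun ω hω => (hint ω (by linarith)).trans ?_⟩
  exact mul_le_mul_of_nonneg_left
    (Real.rpow_le_rpow_of_exponent_le (by linarith) (by linarith)) hK.le
end

section
/- Let ω > 0 and β ∈ ℝ with β ≠ −1. Define F : ℝ → ℂ by F(u) = (e^{iωu} − 1)/u for u ≠ 0 and F(0) = iω. Then ∫₁^∞ (t² − 1)^{−1/2} F(β + t) dt = i ∫₀^∞ t^{−1/2} (2i − t)^{−1/2} (e^{i(β+1)ω} e^{−tω} − 1)/(1 + β + it) dt, where for a complex number z, z^{−1/2} = 1/√z with √ the principal branch of the complex square root (having nonnegative real part), and both integrals converge absolutely. -/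
open MeasureTheory Set

open Filter Topology in
/-- **Rotation of the positive real axis to the positive imaginary axis**: if `f` is holomorphic
on the closed first quadrant minus the origin and dominated there by an integrable radial function
`φ` with `r * φ r → 0` at `0` and at `∞`, its integrals along the two bounding rays agree. -/
theorem integral_Ioi_eq_I_mul_integral_Ioi_of_quadrant {f : ℂ → ℂ} {φ : ℝ → ℝ}
    (hd : ∀ z : ℂ, 0 ≤ z.re → 0 ≤ z.im → z ≠ 0 → DifferentiableAt ℂ f z)
    (hb : ∀ z : ℂ, 0 ≤ z.re → 0 ≤ z.im → z ≠ 0 → ‖f z‖ ≤ φ ‖z‖)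
    (hφ : IntegrableOn φ (Ioi 0))
    (hφ0 : Tendsto (fun r => r * φ r) (𝓝[>] 0) (𝓝 0))
    (hφt : Tendsto (fun r => r * φ r) atTop (𝓝 0)) :
    IntegrableOn (fun t : ℝ => f t) (Ioi 0) ∧
    IntegrableOn (fun t : ℝ => f (t * Complex.I)) (Ioi 0) ∧
    ∫ t in Ioi (0 : ℝ), f t = Complex.I * ∫ t in Ioi (0 : ℝ), f (t * Complex.I) := by
  have hray : ∀ a : ℂ, ‖a‖ = 1 → 0 ≤ a.re → 0 ≤ a.im →
      IntegrableOn (fun t : ℝ => f (t * a)) (Ioi 0) := by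
    intro a ha hre him
    have ha0 : a ≠ 0 := by rintro rfl; simp at ha
    have hq : ∀ t : ℝ, 0 < t → 0 ≤ (t * a).re ∧ 0 ≤ (t * a).im ∧ (t * a : ℂ) ≠ 0 := by
      intro t ht
      refine ⟨?_, ?_, mul_ne_zero (by exact_mod_cast ht.ne') ha0⟩
      · simpa using mul_nonneg ht.le hre
      · simpa using mul_nonneg ht.le him
    refine Integrable.mono' hφ ?_ ?_
    · refine ContinuousOn.aestronglyMeasurable (fun t ht => ?_) measurableSet_Ioi
      obtain ⟨h1, h2, h3⟩ := hq t ht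
      have hc : ContinuousAt (fun t : ℝ => (t * a : ℂ)) t := by fun_prop
      exact (ContinuousAt.comp (f := fun t : ℝ => (t * a : ℂ)) (hd _ h1 h2 h3).continuousAt
        hc).continuousWithinAt
    · filter_upwards [self_mem_ae_restrict measurableSet_Ioi] with t ht
      obtain ⟨h1, h2, h3⟩ := hq t ht
      simpa [ha, abs_of_pos (mem_Ioi.1 ht)] using hb _ h1 h2 h3
  have hI1 : IntegrableOn (fun t : ℝ => f t) (Ioi 0) := by simpa using hray 1 (by simp)
  have hI2 := hray Complex.I (by simp) (by simp) (by simp)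
  refine ⟨hI1, hI2, ?_⟩
  -- Substitute `z = exp ζ` and integrate over rectangles `[-T, T] × [0, π / 2]`.
  have hexp : ∀ g : ℝ → ℂ, IntegrableOn g (Ioi 0) →
      Tendsto (fun T : ℝ => ∫ s in (-T)..T, (Real.exp s : ℂ) * g (Real.exp s)) atTop
        (𝓝 (∫ t in Ioi (0 : ℝ), g t)) := by
    intro g hg
    have hder : ∀ x ∈ (univ : Set ℝ), HasDerivWithinAt Real.exp (Real.exp x) univ x :=
      fun x _ => (Real.hasDerivAt_exp x).hasDerivWithinAt
    have himg : Real.exp '' univ = Ioi 0 := by rw [image_univ, Real.range_exp]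
    have h1 := integrableOn_image_iff_integrableOn_abs_deriv_smul MeasurableSet.univ hder
      Real.exp_injective.injOn g
    have h2 := integral_image_eq_integral_abs_deriv_smul MeasurableSet.univ hder
      Real.exp_injective.injOn g
    simp only [himg, integrableOn_univ, Measure.restrict_univ, Real.abs_exp,
      Complex.real_smul] at h1 h2
    rw [h2]
    exact intervalIntegral_tendsto_integral (h1.1 hg) tendsto_neg_atTop_atBot tendsto_id
  set h : ℂ → ℂ := fun ζ => f (Complex.exp ζ) * Complex.exp ζ with hh
  have hq : ∀ ζ : ℂ, 0 ≤ ζ.im → ζ.im ≤ Real.pi / 2 →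
      0 ≤ (Complex.exp ζ).re ∧ 0 ≤ (Complex.exp ζ).im := by
    intro ζ h0 h1
    rw [Complex.exp_re, Complex.exp_im]
    have := Real.pi_pos
    exact ⟨mul_nonneg (Real.exp_pos _).le (Real.cos_nonneg_of_mem_Icc ⟨by linarith, h1⟩),
      mul_nonneg (Real.exp_pos _).le (Real.sin_nonneg_of_nonneg_of_le_pi h0 (by linarith))⟩
  have hside : ∀ x : ℝ, ‖∫ y : ℝ in (0 : ℝ)..(Real.pi / 2), h (x + y * Complex.I)‖ ≤
      (Real.exp x * φ (Real.exp x)) * (Real.pi / 2) := by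
    intro x
    have hpi := Real.pi_pos
    have := intervalIntegral.norm_integral_le_of_norm_le_const (a := 0) (b := Real.pi / 2)
      (f := fun y : ℝ => h (x + y * Complex.I)) (C := Real.exp x * φ (Real.exp x)) ?_
    · rwa [sub_zero, abs_of_pos (by positivity)] at this
    · intro y hy
      rw [uIoc_of_le (by positivity)] at hy
      obtain ⟨h1, h2⟩ := hq (x + y * Complex.I) (by simpa using hy.1.le) (by simpa using hy.2)
      have hn : ‖Complex.exp (x + y * Complex.I)‖ = Real.exp x := by simp [Complex.norm_exp]
      have := hb _ h1 h2 (Complex.exp_ne_zero _)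
      rw [hn] at this
      rw [hh, norm_mul, hn, mul_comm]
      exact mul_le_mul_of_nonneg_left this (Real.exp_pos x).le
  have hright : Tendsto (fun T : ℝ => ∫ y : ℝ in (0 : ℝ)..(Real.pi / 2),
      h ((T : ℝ) + y * Complex.I)) atTop (𝓝 0) := by
    refine squeeze_zero_norm hside ?_
    simpa using (hφt.comp Real.tendsto_exp_atTop).mul_const (Real.pi / 2)
  have hleft : Tendsto (fun T : ℝ => ∫ y : ℝ in (0 : ℝ)..(Real.pi / 2),
      h ((-T : ℝ) + y * Complex.I)) atTop (𝓝 0) := by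
    refine squeeze_zero_norm (fun T => hside (-T)) ?_
    simpa using (hφ0.comp
      (Real.tendsto_exp_atBot_nhdsGT.comp tendsto_neg_atTop_atBot)).mul_const (Real.pi / 2)
  have hrect : ∀ T : ℝ,
      (∫ s in (-T)..T, (Real.exp s : ℂ) * f (Real.exp s)) -
        Complex.I * (∫ s in (-T)..T, (Real.exp s : ℂ) * f (Real.exp s * Complex.I)) +
        Complex.I * (∫ y : ℝ in (0 : ℝ)..(Real.pi / 2), h ((T : ℝ) + y * Complex.I)) -
        Complex.I * (∫ y : ℝ in (0 : ℝ)..(Real.pi / 2), h ((-T : ℝ) + y * Complex.I)) = 0 := by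
    intro T
    have key := Complex.integral_boundary_rect_eq_zero_of_differentiableOn h
      ⟨-T, 0⟩ ⟨T, Real.pi / 2⟩ ?_
    · rw [← key]
      simp only [smul_eq_mul]
      congr 3
      · refine intervalIntegral.integral_congr fun s _ => ?_
        simp [hh, mul_comm]
      · rw [← intervalIntegral.integral_const_mul]
        refine intervalIntegral.integral_congr fun s _ => ?_
        have : Complex.exp (s + (Real.pi / 2 : ℝ) * Complex.I) =
            Complex.exp s * Complex.I := by
          rw [Complex.exp_add]; push_cast; rw [Complex.exp_pi_div_two_mul_I]
        simp only [hh, this, Complex.ofReal_exp]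
        ring
    · intro ζ hζ
      rw [Complex.mem_reProdIm, uIcc_of_le (a := (0:ℝ)) (by positivity)] at hζ
      obtain ⟨h1, h2⟩ := hq ζ hζ.2.1 hζ.2.2
      exact (((hd _ h1 h2 (Complex.exp_ne_zero _)).comp ζ Complex.differentiableAt_exp).mul
        Complex.differentiableAt_exp).differentiableWithinAt
  have hlim := (((hexp _ hI1).sub ((hexp _ hI2).const_mul Complex.I)).add
    (hright.const_mul Complex.I)).sub (hleft.const_mul Complex.I)
  simp only [hrect] at hlim
  have := tendsto_nhds_unique hlim tendsto_const_nhds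
  simpa [sub_eq_zero] using this

theorem integrableOn_Ioi_rpow_neg_half_mul_inv_one_add :
    IntegrableOn (fun r : ℝ => r ^ (-(1 / 2) : ℝ) * (1 + r)⁻¹) (Ioi 0) := by
  have hm : ∀ s : Set ℝ, AEStronglyMeasurable (fun r : ℝ => r ^ (-(1 / 2) : ℝ) * (1 + r)⁻¹)
      (volume.restrict s) := fun s => Measurable.aestronglyMeasurable (by fun_prop)
  rw [← Ioc_union_Ioi_eq_Ioi zero_le_one]
  refine IntegrableOn.union ?_ ?_
  · have h := (intervalIntegral.intervalIntegrable_rpow' (a := 0) (b := 1)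
      (r := -(1 / 2)) (by norm_num)).1
    refine Integrable.mono' h (hm _) ?_
    filter_upwards [self_mem_ae_restrict measurableSet_Ioc] with r hr
    have hr0 := hr.1
    rw [Real.norm_of_nonneg (by positivity)]
    exact mul_le_of_le_one_right (by positivity) (inv_le_one_of_one_le₀ (by linarith))
  · have h := integrableOn_Ioi_rpow_of_lt (a := -(1 / 2) + -1) (by norm_num) zero_lt_one
    refine Integrable.mono' h (hm _) ?_
    filter_upwards [self_mem_ae_restrict measurableSet_Ioi] with r hr
    have hr0 : 0 < r := zero_lt_one.trans hr
    rw [Real.norm_of_nonneg (by positivity), Real.rpow_add hr0, Real.rpow_neg_one]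
    gcongr
    linarith

open Filter Topology in
theorem tendsto_mul_rpow_neg_half_mul_inv_one_add_nhdsGT_zero :
    Tendsto (fun r : ℝ => r * (r ^ (-(1 / 2) : ℝ) * (1 + r)⁻¹)) (𝓝[>] 0) (𝓝 0) := by
  have h : Tendsto (fun r : ℝ => r ^ (1 / 2 : ℝ)) (𝓝[>] 0) (𝓝 0) := by
    have := (Real.continuous_rpow_const (q := 1 / 2) (by norm_num)).tendsto 0
    rw [Real.zero_rpow (by norm_num)] at this
    exact this.mono_left nhdsWithin_le_nhds
  refine squeeze_zero' ?_ ?_ h <;> filter_upwards [self_mem_nhdsWithin] with r hr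
  all_goals have hr0 : 0 < r := hr
  · positivity
  · have : r * r ^ (-(1 / 2) : ℝ) = r ^ (1 / 2 : ℝ) := by
      rw [← Real.rpow_one_add' hr0.le (by norm_num)]; norm_num
    rw [← mul_assoc, this]
    exact mul_le_of_le_one_right (by positivity) (inv_le_one_of_one_le₀ (by linarith))

open Filter Topology in
theorem tendsto_mul_rpow_neg_half_mul_inv_one_add_atTop :
    Tendsto (fun r : ℝ => r * (r ^ (-(1 / 2) : ℝ) * (1 + r)⁻¹)) atTop (𝓝 0) := by
  refine squeeze_zero' ?_ ?_ (tendsto_rpow_neg_atTop (y := 1 / 2) (by norm_num)) <;>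
    filter_upwards [eventually_gt_atTop 0] with r hr
  · positivity
  · rw [mul_left_comm]
    refine mul_le_of_le_one_right (by positivity) ?_
    rw [← div_eq_mul_inv, div_le_one (by positivity)]
    linarith

/-- The divided difference `(exp (iωz) - 1) / z` is entire. -/
theorem differentiable_dslope_exp_I_mul (ω : ℝ) :
    Differentiable ℂ (dslope (fun z : ℂ => Complex.exp (Complex.I * ω * z)) 0) := by
  rw [← differentiableOn_univ, Complex.differentiableOn_dslope Filter.univ_mem]
  fun_prop

theorem dslope_exp_I_mul_of_ne (ω : ℝ) {z : ℂ} (hz : z ≠ 0) :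
    dslope (fun z : ℂ => Complex.exp (Complex.I * ω * z)) 0 z =
      (Complex.exp (Complex.I * ω * z) - 1) / z := by
  simp [dslope_of_ne _ hz, slope_def_field]

theorem dslope_exp_I_mul_zero (ω : ℝ) :
    dslope (fun z : ℂ => Complex.exp (Complex.I * ω * z)) 0 0 = Complex.I * ω := by
  have h : HasDerivAt (fun z : ℂ => Complex.exp (Complex.I * ω * z)) (Complex.I * ω) 0 := by
    simpa using ((hasDerivAt_id (0 : ℂ)).const_mul (Complex.I * ω)).cexp
  rw [dslope_same, h.deriv]

/-- The divided difference `(exp (iωz) - 1) / z` decays like `1 / z` in the upper half plane,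
uniformly along horizontal translates. -/
theorem exists_norm_dslope_exp_I_mul_add_le {ω : ℝ} (hω : 0 ≤ ω) (c : ℝ) :
    ∃ C : ℝ, 0 ≤ C ∧ ∀ z : ℂ, 0 ≤ z.im →
      ‖dslope (fun z : ℂ => Complex.exp (Complex.I * ω * z)) 0 (c + z)‖ ≤ C * (1 + ‖z‖)⁻¹ := by
  obtain ⟨M, hM⟩ := (isCompact_closedBall (0 : ℂ) 1).exists_bound_of_continuousOn
    (differentiable_dslope_exp_I_mul ω).continuous.continuousOn
  have hM0 : 0 ≤ M := (norm_nonneg _).trans (hM 0 (by simp))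
  refine ⟨(2 * M + 4) * (1 + |c|), by positivity, fun z hz => ?_⟩
  have hnorm : 1 + ‖z‖ ≤ (1 + |c|) * (1 + ‖(c + z : ℂ)‖) := by
    have h1 : ‖z‖ ≤ ‖(c + z : ℂ)‖ + |c| := by
      simpa using norm_sub_le (c + z : ℂ) c
    nlinarith [mul_nonneg (abs_nonneg c) (norm_nonneg (c + z : ℂ))]
  have him : 0 ≤ (c + z : ℂ).im := by simpa using hz
  generalize (c + z : ℂ) = u at hnorm him
  have hu : ‖dslope (fun z : ℂ => Complex.exp (Complex.I * ω * z)) 0 u‖ * (1 + ‖u‖) ≤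
      2 * M + 4 := by
    rcases le_total ‖u‖ 1 with h1 | h1
    · have := hM u (by simpa using h1)
      nlinarith [norm_nonneg u]
    · have hu0 : u ≠ 0 := by rintro rfl; simp at h1; linarith
      have hn : ‖Complex.exp (Complex.I * ω * u) - 1‖ ≤ 2 := by
        refine (norm_sub_le _ _).trans ?_
        have : ‖Complex.exp (Complex.I * ω * u)‖ ≤ 1 := by
          rw [Complex.norm_exp, Real.exp_le_one_iff]
          simpa using mul_nonneg hω him
        rw [norm_one]; linarith
      rw [dslope_exp_I_mul_of_ne ω hu0, norm_div, div_mul_eq_mul_div, div_le_iff₀ (by linarith)]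
      nlinarith [norm_nonneg u]
  rw [← div_eq_mul_inv, le_div_iff₀ (by positivity)]
  calc _ ≤ _ := mul_le_mul_of_nonneg_left hnorm (norm_nonneg _)
    _ = _ * (1 + |c|) := by rw [mul_comm (1 + |c|), ← mul_assoc]
    _ ≤ _ := by gcongr

theorem ofReal_mul_cpow {r : ℝ} (hr : 0 < r) {z : ℂ} (hz : z ≠ 0) (s : ℂ) :
    (r * z : ℂ) ^ s = (r : ℂ) ^ s * z ^ s := by
  have hr' : (r : ℂ) ≠ 0 := by exact_mod_cast hr.ne'
  rw [Complex.cpow_def_of_ne_zero (mul_ne_zero hr' hz), Complex.cpow_def_of_ne_zero hr',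
    Complex.cpow_def_of_ne_zero hz, Complex.log_ofReal_mul hr hz, ← Complex.ofReal_log hr.le,
    add_mul, Complex.exp_add]

theorem mul_add_two_mem_slitPlane {z : ℂ} (hre : 0 ≤ z.re) (him : 0 ≤ z.im) (hz : z ≠ 0) :
    z * (z + 2) ∈ Complex.slitPlane := by
  rw [Complex.mem_slitPlane_iff]
  rcases him.eq_or_lt with h | h
  · left
    have : 0 < z.re := hre.lt_of_ne fun h' => hz (Complex.ext h'.symm h.symm)
    simp [← h]; positivity
  · right
    simp
    nlinarith [mul_nonneg hre him]

theorem norm_mul_add_two_cpow_neg_half_le {z : ℂ} (hre : 0 ≤ z.re) (hz : z ≠ 0) :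
    ‖(z * (z + 2)) ^ (-(1 / 2) : ℂ)‖ ≤ ‖z‖ ^ (-(1 / 2) : ℝ) := by
  have h := Complex.norm_cpow_real (z * (z + 2)) (-(1 / 2))
  push_cast at h
  rw [h]
  have hz0 : 0 < ‖z‖ := norm_pos_iff.2 hz
  refine Real.rpow_le_rpow_of_nonpos hz0 ?_ (by norm_num)
  rw [norm_mul]
  refine le_mul_of_one_le_right hz0.le ?_
  have := Complex.re_le_norm (z + 2)
  simp at this
  linarith

/-- **Contour-rotation identity for the zeroth moment** (underlying Lemma 3.3). With
`F(u) = (e^{iωu} − 1)/u` (and `F(0) = iω`), the Mehler–Sonine-type integral over `(1,∞)`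
equals `i` times an exponentially decaying integral over `(0,∞)`; here `z^{-1/2}` is the
principal branch `cpow`, whose square root has nonnegative real part. Both integrals
converge absolutely. -/
theorem contour_rotation_zeroth_moment (ω β : ℝ) (hω : 0 < ω) (hβ : β ≠ -1)
    (F : ℝ → ℂ)
    (hF : ∀ u : ℝ, u ≠ 0 → F u = (Complex.exp (Complex.I * (ω : ℂ) * (u : ℂ)) - 1) / (u : ℂ))
    (hF0 : F 0 = Complex.I * (ω : ℂ)) :
    IntegrableOn (fun t : ℝ => ((t : ℂ) ^ 2 - 1) ^ (-(1/2) : ℂ) * F (β + t)) (Ioi 1) ∧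
    IntegrableOn (fun t : ℝ =>
      (t : ℂ) ^ (-(1/2) : ℂ) * (2 * Complex.I - (t : ℂ)) ^ (-(1/2) : ℂ) *
        ((Complex.exp (Complex.I * (((β + 1) * ω : ℝ) : ℂ)) * Complex.exp (-((t * ω : ℝ) : ℂ)) - 1)
          / (1 + (β : ℂ) + Complex.I * (t : ℂ)))) (Ioi 0) ∧
    (∫ t in Ioi (1:ℝ), ((t : ℂ) ^ 2 - 1) ^ (-(1/2) : ℂ) * F (β + t))
      = Complex.I * ∫ t in Ioi (0:ℝ),
          (t : ℂ) ^ (-(1/2) : ℂ) * (2 * Complex.I - (t : ℂ)) ^ (-(1/2) : ℂ) *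
            ((Complex.exp (Complex.I * (((β + 1) * ω : ℝ) : ℂ)) * Complex.exp (-((t * ω : ℝ) : ℂ)) - 1)
              / (1 + (β : ℂ) + Complex.I * (t : ℂ))) := by
  set E : ℂ → ℂ := dslope (fun z : ℂ => Complex.exp (Complex.I * ω * z)) 0 with hE
  have hFE : ∀ u : ℝ, F u = E u := by
    intro u
    rcases eq_or_ne u 0 with rfl | hu
    · rw [hF0, Complex.ofReal_zero, hE, dslope_exp_I_mul_zero]
    · rw [hF u hu, hE, dslope_exp_I_mul_of_ne ω (by exact_mod_cast hu)]
  obtain ⟨C, hC0, hC⟩ := exists_norm_dslope_exp_I_mul_add_le hω.le (β + 1)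
  obtain ⟨hI1, hI2, hI⟩ := integral_Ioi_eq_I_mul_integral_Ioi_of_quadrant
    (f := fun z => (z * (z + 2)) ^ (-(1 / 2) : ℂ) * E ((β + 1 : ℝ) + z))
    (φ := fun r => C * (r ^ (-(1 / 2) : ℝ) * (1 + r)⁻¹))
    (fun z hre him hz => by
      refine DifferentiableAt.mul ?_ ?_
      · exact DifferentiableAt.cpow (by fun_prop) (by fun_prop)
          (mul_add_two_mem_slitPlane hre him hz)
      · exact ((differentiable_dslope_exp_I_mul ω) _).comp z (by fun_prop))
    (fun z hre him hz => by
      rw [norm_mul, mul_left_comm]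
      exact mul_le_mul (norm_mul_add_two_cpow_neg_half_le hre hz) (hC z him) (norm_nonneg _)
        (by positivity))
    (integrableOn_Ioi_rpow_neg_half_mul_inv_one_add.const_mul C)
    (by simpa [mul_left_comm] using
      tendsto_mul_rpow_neg_half_mul_inv_one_add_nhdsGT_zero.const_mul C)
    (by simpa [mul_left_comm] using
      tendsto_mul_rpow_neg_half_mul_inv_one_add_atTop.const_mul C)
  have hshift : (fun t : ℝ => ((t : ℂ) ^ 2 - 1) ^ (-(1/2) : ℂ) * F (β + t)) ∘ (· + 1) =
      fun t : ℝ => ((t : ℂ) * (t + 2)) ^ (-(1 / 2) : ℂ) * E ((β + 1 : ℝ) + t) := by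
    funext t
    simp only [Function.comp_apply, hFE]
    push_cast
    ring_nf
  have hrot : ∀ t ∈ Ioi (0 : ℝ),
      ((t * Complex.I : ℂ) * (t * Complex.I + 2)) ^ (-(1 / 2) : ℂ) *
        E ((β + 1 : ℝ) + t * Complex.I) =
      (t : ℂ) ^ (-(1/2) : ℂ) * (2 * Complex.I - (t : ℂ)) ^ (-(1/2) : ℂ) *
        ((Complex.exp (Complex.I * (((β + 1) * ω : ℝ) : ℂ)) * Complex.exp (-((t * ω : ℝ) : ℂ)) - 1)
          / (1 + (β : ℂ) + Complex.I * (t : ℂ))) := by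
    intro t ht
    have h1 : (2 * Complex.I - t : ℂ) ≠ 0 := fun h => by simpa using congrArg Complex.im h
    have h2 : (((β + 1 : ℝ) : ℂ) + t * Complex.I) ≠ 0 := fun h => by
      have := congrArg Complex.re h
      simp at this
      exact hβ (by linarith)
    have h3 : (t * Complex.I : ℂ) * (t * Complex.I + 2) = t * (2 * Complex.I - t) := by
      linear_combination (t : ℂ) ^ 2 * Complex.I_sq
    rw [h3, ofReal_mul_cpow ht h1, hE, dslope_exp_I_mul_of_ne ω h2, ← Complex.exp_add]
    congr 2
    · congr 2
      push_cast
      linear_combination (ω * t : ℂ) * Complex.I_sq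
    · push_cast
      ring
  have hmp : MeasurePreserving (fun t : ℝ => t + 1) := measurePreserving_add_right volume 1
  have hme : MeasurableEmbedding (fun t : ℝ => t + 1) := measurableEmbedding_addRight 1
  have hpre : (fun t : ℝ => t + 1) ⁻¹' Ioi 1 = Ioi 0 := by ext; simp
  refine ⟨?_, hI2.congr_fun hrot measurableSet_Ioi, ?_⟩
  · rw [← hmp.integrableOn_comp_preimage hme, hshift, hpre]
    exact hI1
  · rw [← hmp.setIntegral_preimage_emb hme, hpre, ← setIntegral_congr_fun measurableSet_Ioi hrot,
      ← hI]
    exact congrArg (fun g : ℝ → ℂ => ∫ t in Ioi 0, g t) hshift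
end

section
/- Let ω > 0 and β ∈ ℝ, and let u : (0,∞) → ℂ be twice differentiable and satisfy Bessel's equation of order zero, z·u″(z) + u′(z) + z·u(z) = 0 for all z > 0. Define w : (−1,1) → ℂ by w(y) = √(1−y²) · u(ω(y+1)/2) · e^{iωβ(y+1)/2}, and let D denote the differential operator (D v)(y) = (1−y²) v′(y). Then for all y ∈ (−1,1): (D(Dw))(y) + i(βω(y²−1) − i(3y+1))·(Dw)(y) − (1/4)·((β²−1)ω²(y²−1)² − 2iβω(y−1)(y+1)² − 4(y²+y+1))·w(y) = 0. -/
open Set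

/-- The weight `√(1 - y²)` is an eigenfunction of `(1 - y²) d/dy` up to the factor `-y`. -/
theorem hasDerivAt_ofReal_sqrt_one_sub_sq {y : ℝ} (hy : y ∈ Ioo (-1 : ℝ) 1) :
    HasDerivAt (fun x : ℝ => ((Real.sqrt (1 - x ^ 2) : ℝ) : ℂ))
      (-(y : ℂ) / (1 - (y : ℂ) ^ 2) * ((Real.sqrt (1 - y ^ 2) : ℝ) : ℂ)) y := by
  have hp : 0 < 1 - y ^ 2 := by nlinarith [hy.1, hy.2]
  have hq : HasDerivAt (fun x : ℝ => 1 - x ^ 2) (-(2 * y)) y := by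
    simpa using (hasDerivAt_pow 2 y).const_sub 1
  have hs : Real.sqrt (1 - y ^ 2) ≠ 0 := (Real.sqrt_pos.2 hp).ne'
  have hsq : Real.sqrt (1 - y ^ 2) ^ 2 = 1 - y ^ 2 := Real.sq_sqrt hp.le
  convert (hq.sqrt hp.ne').ofReal_comp using 1
  have h : -(2 * y) / (2 * Real.sqrt (1 - y ^ 2))
      = -y / (1 - y ^ 2) * Real.sqrt (1 - y ^ 2) := by
    rw [div_mul_eq_mul_div, div_eq_div_iff (by positivity) hp.ne']
    linear_combination 2 * y * hsq
  rw [h]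
  push_cast
  ring

/-- The derivative of a function of the form `√(1 - y²) · g(y) · e^{i c (y + 1) / 2}`, multiplied
by `1 - y²`. -/
theorem one_sub_sq_mul_deriv_weighted {c y : ℝ} {g : ℝ → ℂ} {g' : ℂ}
    (hy : y ∈ Ioo (-1 : ℝ) 1) (hg : HasDerivAt g g' y) :
    ((1 - y ^ 2 : ℝ) : ℂ) * deriv (fun x : ℝ => ((Real.sqrt (1 - x ^ 2) : ℝ) : ℂ) * g x
        * Complex.exp (Complex.I * ((c * (x + 1) / 2 : ℝ) : ℂ))) y
      = ((Real.sqrt (1 - y ^ 2) : ℝ) : ℂ)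
        * ((-(y : ℂ) + (1 - (y : ℂ) ^ 2) * (Complex.I * c / 2)) * g y
          + (1 - (y : ℂ) ^ 2) * g')
        * Complex.exp (Complex.I * ((c * (y + 1) / 2 : ℝ) : ℂ)) := by
  have hp : (1 - (y : ℂ) ^ 2) ≠ 0 := by
    have : 1 - y ^ 2 ≠ 0 := by nlinarith [hy.1, hy.2]
    exact_mod_cast this
  have hlin : HasDerivAt (fun x : ℝ => c * (x + 1) / 2) (c / 2) y := by
    simpa using (((hasDerivAt_id y).add_const 1).const_mul c).div_const 2
  have hexp := (hlin.ofReal_comp.const_mul Complex.I).cexp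
  have hprod := ((hasDerivAt_ofReal_sqrt_one_sub_sq hy).mul hg).mul hexp
  refine (congrArg (((1 - y ^ 2 : ℝ) : ℂ) * ·) hprod.deriv).trans ?_
  simp only [Complex.ofReal_sub, Complex.ofReal_one, Complex.ofReal_pow, Complex.ofReal_div,
    Complex.ofReal_ofNat, Pi.mul_apply]
  field_simp
  ring

/-- **The weighted kernel satisfies the operator equation `L_ω⁽¹⁾ w = 0`** (equations (3.4),
(3.6)). If `u` solves Bessel's equation of order zero on `(0,∞)` and
`w(y) = √(1−y²)·u(ω(y+1)/2)·e^{iωβ(y+1)/2}`, then with `D = (1−y²)d/dy` we have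
`D²w + i(βω(y²−1) − i(3y+1))Dw − ¼((β²−1)ω²(y²−1)² − 2iβω(y−1)(y+1)² − 4(y²+y+1))w = 0`
on `(−1,1)`. -/
theorem weighted_kernel_operator_equation (ω β : ℝ) (hω : 0 < ω) (u : ℝ → ℂ)
    (hu1 : ∀ z : ℝ, 0 < z → DifferentiableAt ℝ u z)
    (hu2 : ∀ z : ℝ, 0 < z → DifferentiableAt ℝ (deriv u) z)
    (hbessel : ∀ z : ℝ, 0 < z →
      (z : ℂ) * deriv (deriv u) z + deriv u z + (z : ℂ) * u z = 0)
    (w : ℝ → ℂ)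
    (hw : ∀ y : ℝ, w y = ((Real.sqrt (1 - y ^ 2) : ℝ) : ℂ) * u (ω * (y + 1) / 2)
        * Complex.exp (Complex.I * ((ω * β * (y + 1) / 2 : ℝ) : ℂ)))
    (D : (ℝ → ℂ) → (ℝ → ℂ))
    (hD : ∀ v : ℝ → ℂ, ∀ y : ℝ, D v y = ((1 - y ^ 2 : ℝ) : ℂ) * deriv v y) :
    ∀ y ∈ Ioo (-1 : ℝ) 1,
      D (D w) y
        + Complex.I * (((β * ω * (y ^ 2 - 1) : ℝ) : ℂ) - Complex.I * ((3 * y + 1 : ℝ) : ℂ))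
            * D w y
        - (1/4 : ℂ) * ((((β ^ 2 - 1) * ω ^ 2 * (y ^ 2 - 1) ^ 2 : ℝ) : ℂ)
            - 2 * Complex.I * ((β * ω * (y - 1) * (y + 1) ^ 2 : ℝ) : ℂ)
            - ((4 * (y ^ 2 + y + 1) : ℝ) : ℂ)) * w y = 0 := by
  intro y hy
  have hz : ∀ x ∈ Ioo (-1 : ℝ) 1, 0 < ω * (x + 1) / 2 := fun x hx => by
    have : 0 < x + 1 := by linarith [hx.1]
    positivity
  have hlin : ∀ x : ℝ, HasDerivAt (fun x : ℝ => ω * (x + 1) / 2) (ω / 2) x := fun x => by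
    simpa using (((hasDerivAt_id x).add_const 1).const_mul ω).div_const 2
  have hu : ∀ x ∈ Ioo (-1 : ℝ) 1, HasDerivAt (fun x : ℝ => u (ω * (x + 1) / 2))
      ((ω / 2 : ℝ) • deriv u (ω * (x + 1) / 2)) x := fun x hx =>
    (hu1 _ (hz x hx)).hasDerivAt.scomp x (hlin x)
  have hu' : HasDerivAt (fun x : ℝ => deriv u (ω * (x + 1) / 2))
      ((ω / 2 : ℝ) • deriv (deriv u) (ω * (y + 1) / 2)) y :=
    HasDerivAt.scomp (g₁ := deriv u) y (hu2 _ (hz y hy)).hasDerivAt (hlin y)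
  have hDw : ∀ x ∈ Ioo (-1 : ℝ) 1, D w x = ((Real.sqrt (1 - x ^ 2) : ℝ) : ℂ)
      * ((-(x : ℂ) + (1 - (x : ℂ) ^ 2) * (Complex.I * (ω * β : ℝ) / 2)) * u (ω * (x + 1) / 2)
        + (1 - (x : ℂ) ^ 2) * ((ω / 2 : ℝ) • deriv u (ω * (x + 1) / 2)))
      * Complex.exp (Complex.I * ((ω * β * (x + 1) / 2 : ℝ) : ℂ)) := fun x hx => by
    rw [hD, funext hw]
    exact one_sub_sq_mul_deriv_weighted hx (hu x hx)
  have hid : HasDerivAt (fun x : ℝ => (x : ℂ)) 1 y := by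
    simpa using (hasDerivAt_id y).ofReal_comp
  have hsq : HasDerivAt (fun x : ℝ => 1 - (x : ℂ) ^ 2) (-(2 * (y : ℂ))) y := by
    simpa using (hid.pow 2).const_sub 1
  have hg := ((hid.neg.add (hsq.mul_const (Complex.I * (ω * β : ℝ) / 2))).mul (hu y hy)).add
    (hsq.mul (hu'.const_smul (ω / 2)))
  have hDDw := one_sub_sq_mul_deriv_weighted (c := ω * β) hy hg
  rw [hD (D w), (Filter.eventuallyEq_of_mem (Ioo_mem_nhds hy.1 hy.2) hDw).deriv_eq]
  refine (congrArg (fun t => t + _ - _) hDDw).trans ?_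
  rw [hDw y hy, hw y]
  have hb := hbessel _ (hz y hy)
  simp only [Pi.add_apply, Pi.mul_apply, Pi.neg_apply, Pi.smul_apply, Complex.real_smul]
  push_cast at hb ⊢
  generalize Complex.exp _ = E
  generalize ((Real.sqrt (1 - y ^ 2) : ℝ) : ℂ) = s
  generalize deriv (deriv u) (ω * (y + 1) / 2) = u₂ at hb ⊢
  generalize deriv u (ω * (y + 1) / 2) = u₁ at hb ⊢
  generalize u (ω * (y + 1) / 2) = u₀ at hb ⊢
  have hI := Complex.I_sq
  linear_combination
    s * E * (1 - (y : ℂ) ^ 2) * (1 - (y : ℂ)) * (ω / 2) * hb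
      + s * E * (-(1 - (y : ℂ) ^ 2) ^ 2 * (ω * β / 2) ^ 2 * u₀
        - (3 * y + 1) * ((-(y : ℂ) + (1 - (y : ℂ) ^ 2) * (Complex.I * (ω * β) / 2)) * u₀
          + (1 - (y : ℂ) ^ 2) * (ω / 2) * u₁)) * hI
end

section
/- Let C, β ∈ ℝ with C > 0 and β ≠ 1, β ≠ −1. Then for every λ ∈ ℂ the following polynomial identity holds: (C²(1−β²)/4)λ⁸ + 2iβC λ⁷ + (4 − C²(1−β²))λ⁶ − 6iβC λ⁵ + (−8 + (3/2)C²(1−β²))λ⁴ + 6iβC λ³ + (4 − C²(1−β²))λ² − 2iβC λ + C²(1−β²)/4 = (C²(1−β²)/4)·(λ²−1)²·(λ² − (4i/(C(β−1)))λ − 1)·(λ² − (4i/(C(β+1)))λ − 1). In particular the roots of the left-hand polynomial are −1 and 1 (each of multiplicity two) together with the two roots of λ² − (4i/(C(β−1)))λ − 1 and the two roots of λ² − (4i/(C(β+1)))λ − 1, i.e. (2i ± √(C²(1−β)²−4))/(C(β−1)) and (2i ± √(C²(1+β)²−4))/(C(β+1)). -/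
/-- **Exact factorization of the leading-order characteristic polynomial** (equation (3.15))
of the eight-term recurrence for the moments `σₙ⁽¹⁾`, with `C = ω/n`: the degree-eight
polynomial factors as `(C²(1−β²)/4)(λ²−1)²(λ² − (4i/(C(β−1)))λ − 1)(λ² − (4i/(C(β+1)))λ − 1)`,
so its roots are `±1` (double) and `(2i ± √(C²(1∓β)²−4))/(C(β∓1))`. -/
theorem characteristic_polynomial_factorization (C β : ℝ) (hC : 0 < C)
    (hβ1 : β ≠ 1) (hβ2 : β ≠ -1) (lam : ℂ) :
    ((C ^ 2 * (1 - β ^ 2) / 4 : ℝ) : ℂ) * lam ^ 8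
      + 2 * Complex.I * (β : ℂ) * (C : ℂ) * lam ^ 7
      + ((4 : ℂ) - ((C ^ 2 * (1 - β ^ 2) : ℝ) : ℂ)) * lam ^ 6
      - 6 * Complex.I * (β : ℂ) * (C : ℂ) * lam ^ 5
      + ((-8 : ℂ) + ((3 / 2 * C ^ 2 * (1 - β ^ 2) : ℝ) : ℂ)) * lam ^ 4
      + 6 * Complex.I * (β : ℂ) * (C : ℂ) * lam ^ 3
      + ((4 : ℂ) - ((C ^ 2 * (1 - β ^ 2) : ℝ) : ℂ)) * lam ^ 2
      - 2 * Complex.I * (β : ℂ) * (C : ℂ) * lam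
      + ((C ^ 2 * (1 - β ^ 2) / 4 : ℝ) : ℂ)
    = ((C ^ 2 * (1 - β ^ 2) / 4 : ℝ) : ℂ) * (lam ^ 2 - 1) ^ 2
        * (lam ^ 2 - (4 * Complex.I / ((C : ℂ) * ((β : ℂ) - 1))) * lam - 1)
        * (lam ^ 2 - (4 * Complex.I / ((C : ℂ) * ((β : ℂ) + 1))) * lam - 1) := by
  have hC0 : (C : ℂ) ≠ 0 := by exact_mod_cast hC.ne'
  have hsub : (β : ℂ) - 1 ≠ 0 := by exact_mod_cast sub_ne_zero.mpr hβ1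
  have hadd : (β : ℂ) + 1 ≠ 0 := by
    exact_mod_cast fun h => hβ2 (eq_neg_of_add_eq_zero_left h)
  push_cast
  field_simp
  linear_combination
    32 * (β ^ 2 - 1 : ℂ) * lam ^ 2 * (lam ^ 2 - 1) ^ 2 * Complex.I_sq
end

section
/- Let ν be an odd positive integer and s a natural number with 3s ≤ ν. Suppose f₀, …, f_{ν+1} ∈ ℂ and p₀, …, p_{ν+3s+1} ∈ ℂ satisfy the interpolation conditions Σ_{n=0}^{ν+3s+1} pₙ · Tₙ(cos(jπ/(ν+1))) = f_j for every j = 0, …, ν+1. Define p̌ₘ = (2/(ν+1)) · Σ''_{j=0}^{ν+1} f_j cos(jmπ/(ν+1)) for m = 0, …, ν+1. Then p₀ = (1/2)p̌₀, p_{ν+1} = (1/2)p̌_{ν+1}, pₙ = p̌ₙ for 1 ≤ n ≤ ν−3s, and pₙ = p̌ₙ − p_{2ν−n+2} for ν−3s+1 ≤ n ≤ ν. -/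
open Real

open Finset in
/-- The trapezoidal sum, with halved end terms, as a sum of averages over consecutive nodes. -/
theorem sum_range_half_endpoints {N : ℕ} (hN : 0 < N) (g : ℕ → ℂ) :
    ∑ j ∈ range (N + 1), (if j = 0 ∨ j = N then (1 : ℂ) / 2 else 1) * g j =
      (1 / 2) * ∑ j ∈ range N, (g j + g (j + 1)) := by
  obtain ⟨M, rfl⟩ := Nat.exists_eq_succ_of_ne_zero hN.ne'
  have hinner : ∑ j ∈ range M, (if j + 1 = 0 ∨ j + 1 = M.succ then (1 : ℂ) / 2 else 1) * g (j + 1)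
      = ∑ j ∈ range M, g (j + 1) := by
    refine sum_congr rfl fun j hj => ?_
    rw [if_neg (by have := mem_range.1 hj; omega), one_mul]
  rw [sum_range_succ, sum_range_succ', hinner, sum_add_distrib, sum_range_succ' g,
    sum_range_succ (fun j => g (j + 1))]
  simp
  ring

theorem sin_half_mul_sum_cos_add_cos (x : ℝ) (N : ℕ) :
    Real.sin (x / 2) * ∑ j ∈ Finset.range N, (Real.cos (j * x) + Real.cos ((j + 1 : ℕ) * x)) =
      Real.cos (x / 2) * Real.sin (N * x) := by
  induction N with
  | zero => simp
  | succ N ih =>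
    have hx : x = 2 * (x / 2) := by ring
    rw [Finset.sum_range_succ, mul_add, ih, Nat.cast_succ, add_mul, one_mul, Real.cos_add,
      Real.sin_add]
    have hs : Real.sin x = 2 * Real.sin (x / 2) * Real.cos (x / 2) := by
      rw [← Real.sin_two_mul, ← hx]
    have hc : Real.cos x = 2 * Real.cos (x / 2) ^ 2 - 1 := by
      rw [← Real.cos_two_mul, ← hx]
    have h1 := Real.sin_sq_add_cos_sq (x / 2)
    rw [hs, hc]
    linear_combination (-2 * Real.cos (x / 2) * Real.sin (N * x)) * h1

/-- Discrete orthogonality: the trapezoidal sum of `cos (j k π / N)` detects `2 N ∣ k`. -/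
theorem sum_cos_int_mul_pi_div {N : ℕ} (hN : 0 < N) (k : ℤ) :
    ∑ j ∈ Finset.range N,
      (Real.cos (j * (k * π / N)) + Real.cos ((j + 1 : ℕ) * (k * π / N))) =
      if (2 * N : ℤ) ∣ k then 2 * (N : ℝ) else 0 := by
  have hN' : (N : ℝ) ≠ 0 := by positivity
  split_ifs with h
  · obtain ⟨l, rfl⟩ := h
    have hcos (j : ℕ) : Real.cos (j * (((2 * N * l : ℤ) : ℝ) * π / N)) = 1 := by
      rw [← Real.cos_int_mul_two_pi (j * l)]
      congr 1
      push_cast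
      field_simp
    simp only [hcos, Finset.sum_const, Finset.card_range, nsmul_eq_mul]
    ring
  · have hsin : Real.sin (k * π / N / 2) ≠ 0 := by
      rw [Ne, Real.sin_eq_zero_iff]
      rintro ⟨l, hl⟩
      refine h ⟨l, ?_⟩
      field_simp at hl
      exact_mod_cast (by linarith : (k : ℝ) = 2 * N * l)
    refine (mul_eq_zero.1 ?_).resolve_left hsin
    rw [sin_half_mul_sum_cos_add_cos, mul_div_cancel₀ _ hN', Real.sin_int_mul_pi, mul_zero]

/-- Discrete orthogonality of the Chebyshev polynomials at the Clenshaw–Curtis points. -/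
theorem sum_half_endpoints_cos_mul_cos {N : ℕ} (hN : 0 < N) (n m : ℕ) :
    (2 / (N : ℂ)) * ∑ j ∈ Finset.range (N + 1), (if j = 0 ∨ j = N then (1 : ℂ) / 2 else 1) *
      ((Real.cos (n * (j * π / N)) * Real.cos (j * m * π / N) : ℝ) : ℂ) =
      (if (2 * N : ℤ) ∣ n + m then 1 else 0) + (if (2 * N : ℤ) ∣ n - m then 1 else 0) := by
  have hN' : (N : ℂ) ≠ 0 := by exact_mod_cast hN.ne'
  have hprod (j : ℕ) : Real.cos (n * (j * π / N)) * Real.cos (j * m * π / N) =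
      (1 / 2) * (Real.cos (j * (((n + m : ℤ) : ℝ) * π / N)) +
        Real.cos (j * (((n - m : ℤ) : ℝ) * π / N))) := by
    have hadd : j * (((n + m : ℤ) : ℝ) * π / N) = n * (j * π / N) + j * m * π / N := by
      push_cast; ring
    have hsub : j * (((n - m : ℤ) : ℝ) * π / N) = n * (j * π / N) - j * m * π / N := by
      push_cast; ring
    rw [hadd, hsub, Real.cos_add, Real.cos_sub]
    ring
  have hsum := congrArg₂ (· + ·) (sum_cos_int_mul_pi_div hN (n + m))
    (sum_cos_int_mul_pi_div hN (n - m))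
  have hcast : ∑ j ∈ Finset.range N,
      (((Real.cos (n * (j * π / N)) * Real.cos (j * m * π / N) : ℝ) : ℂ) +
        ((Real.cos (n * ((j + 1 : ℕ) * π / N)) * Real.cos ((j + 1 : ℕ) * m * π / N) : ℝ) : ℂ)) =
      (((1 / 2) * ((if (2 * N : ℤ) ∣ n + m then 2 * (N : ℝ) else 0) +
        (if (2 * N : ℤ) ∣ n - m then 2 * (N : ℝ) else 0)) : ℝ) : ℂ) := by
    rw [← hsum]
    simp only [hprod]
    simp only [← Complex.ofReal_add, ← Complex.ofReal_sum, ← Finset.sum_add_distrib,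
      Finset.mul_sum]
    refine congrArg _ (Finset.sum_congr rfl fun j _ => ?_)
    ring
  rw [sum_range_half_endpoints hN, hcast]
  split_ifs <;> push_cast <;> field_simp <;> ring

/-- The inverse DCT-I of a Chebyshev expansion of degree below `2 N` sampled at the
Clenshaw–Curtis points: the coefficient `n` is aliased with `2 N - n`. -/
theorem inverse_dct_chebyshev_sum {N K : ℕ} (hN : 0 < N) (hK : K ≤ 2 * N) (p : ℕ → ℂ) {m : ℕ}
    (hm : m ≤ N) :
    (2 / (N : ℂ)) * ∑ j ∈ Finset.range (N + 1), (if j = 0 ∨ j = N then (1 : ℂ) / 2 else 1) *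
      (∑ n ∈ Finset.range K, p n *
        (((Polynomial.Chebyshev.T ℝ (n : ℤ)).eval (Real.cos (j * π / N)) : ℝ) : ℂ)) *
      ((Real.cos (j * m * π / N) : ℝ) : ℂ) =
      (if (if m = 0 then 0 else 2 * N - m) < K then p (if m = 0 then 0 else 2 * N - m) else 0) +
        (if m < K then p m else 0) := by
  have hexpand : (2 / (N : ℂ)) * ∑ j ∈ Finset.range (N + 1),
      (if j = 0 ∨ j = N then (1 : ℂ) / 2 else 1) *
      (∑ n ∈ Finset.range K, p n *
        (((Polynomial.Chebyshev.T ℝ (n : ℤ)).eval (Real.cos (j * π / N)) : ℝ) : ℂ)) *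
      ((Real.cos (j * m * π / N) : ℝ) : ℂ) =
      ∑ n ∈ Finset.range K, p n * ((2 / (N : ℂ)) * ∑ j ∈ Finset.range (N + 1),
        (if j = 0 ∨ j = N then (1 : ℂ) / 2 else 1) *
        ((Real.cos (n * (j * π / N)) * Real.cos (j * m * π / N) : ℝ) : ℂ)) := by
    simp only [Polynomial.Chebyshev.T_real_cos, Finset.mul_sum, Finset.sum_mul]
    rw [Finset.sum_comm]
    refine Finset.sum_congr rfl fun n _ => Finset.sum_congr rfl fun j _ => ?_
    push_cast
    ring
  have halias : ∀ n ∈ Finset.range K, p n * ((2 / (N : ℂ)) * ∑ j ∈ Finset.range (N + 1),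
        (if j = 0 ∨ j = N then (1 : ℂ) / 2 else 1) *
        ((Real.cos (n * (j * π / N)) * Real.cos (j * m * π / N) : ℝ) : ℂ)) =
      (if n = (if m = 0 then 0 else 2 * N - m) then p n else 0) + (if n = m then p n else 0) := by
    intro n hn
    have hnK := Finset.mem_range.1 hn
    have hadd : (2 * N : ℤ) ∣ n + m ↔ n = if m = 0 then 0 else 2 * N - m := by
      constructor
      · rintro ⟨l, hl⟩
        have hl0 : 0 ≤ l := by by_contra! hlt; nlinarith
        have hl1 : l < 2 := by by_contra! hlt; nlinarith
        interval_cases l <;> split_ifs <;> omega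
      · intro h
        split_ifs at h with hm0
        · simp [h, hm0]
        · exact ⟨1, by omega⟩
    have hsub : (2 * N : ℤ) ∣ n - m ↔ n = m := by
      constructor
      · intro h
        have := Int.eq_zero_of_abs_lt_dvd h (by rw [abs_lt]; constructor <;> omega)
        omega
      · rintro rfl
        simp
    rw [sum_half_endpoints_cos_mul_cos hN]
    simp only [hadd, hsub, mul_add, mul_ite, mul_one, mul_zero]
  rw [hexpand, Finset.sum_congr rfl halias, Finset.sum_add_distrib, Finset.sum_ite_eq',
    Finset.sum_ite_eq']
  simp only [Finset.mem_range]

/-- **Fast Hermite–Clenshaw–Curtis interpolation via DCT-I** (Appendix A / Section 2.3.2).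
If the Chebyshev coefficients `p₀,…,p_{ν+3s+1}` interpolate the data `f_j` at the
Clenshaw–Curtis points `cos(jπ/(ν+1))`, and `p̌ₘ` is the inverse DCT-I of the data (with
the `j = 0` and `j = ν+1` terms halved), then `p₀ = ½p̌₀`, `p_{ν+1} = ½p̌_{ν+1}`,
`pₙ = p̌ₙ` for `1 ≤ n ≤ ν−3s`, and `pₙ = p̌ₙ − p_{2ν−n+2}` for `ν−3s+1 ≤ n ≤ ν`. -/
theorem dct_interpolation_coefficients (ν s : ℕ) (hν : Odd ν) (hνpos : 0 < ν)
    (hs : 3 * s ≤ ν) (f : ℕ → ℂ) (p : ℕ → ℂ)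
    (hinterp : ∀ j : ℕ, j ≤ ν + 1 →
      ∑ n ∈ Finset.range (ν + 3 * s + 2),
        p n * (((Polynomial.Chebyshev.T ℝ (n : ℤ)).eval
            (Real.cos ((j : ℝ) * π / ((ν : ℝ) + 1))) : ℝ) : ℂ) = f j)
    (pcheck : ℕ → ℂ)
    (hpcheck : ∀ m : ℕ, m ≤ ν + 1 →
      pcheck m = (2 / ((ν : ℂ) + 1)) *
        ∑ j ∈ Finset.range (ν + 2),
          (if j = 0 ∨ j = ν + 1 then (1 : ℂ) / 2 else 1) * f j
            * ((Real.cos ((j : ℝ) * (m : ℝ) * π / ((ν : ℝ) + 1)) : ℝ) : ℂ)) :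
    p 0 = (1 / 2) * pcheck 0 ∧
    p (ν + 1) = (1 / 2) * pcheck (ν + 1) ∧
    (∀ n : ℕ, 1 ≤ n → n ≤ ν - 3 * s → p n = pcheck n) ∧
    (∀ n : ℕ, ν - 3 * s + 1 ≤ n → n ≤ ν → p n = pcheck n - p (2 * ν - n + 2)) := by
  have hval (m : ℕ) (hm : m ≤ ν + 1) : pcheck m =
      (if (if m = 0 then 0 else 2 * (ν + 1) - m) < ν + 3 * s + 2 then
        p (if m = 0 then 0 else 2 * (ν + 1) - m) else 0) + p m := by
    have h := inverse_dct_chebyshev_sum (N := ν + 1) (K := ν + 3 * s + 2) (by omega) (by omega) p hm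
    rw [if_pos (by omega : m < ν + 3 * s + 2)] at h
    rw [hpcheck m hm, ← h]
    simp only [Nat.cast_add, Nat.cast_one]
    refine congrArg _ (Finset.sum_congr rfl fun j hj => ?_)
    rw [← hinterp j (by have := Finset.mem_range.1 hj; omega)]
  refine ⟨?_, ?_, fun n hn1 hn => ?_, fun n hn1 hn => ?_⟩
  · rw [hval 0 (by omega)]
    simp
    ring
  · rw [hval (ν + 1) le_rfl, if_neg (Nat.succ_ne_zero ν), if_pos (by omega),
      show 2 * (ν + 1) - (ν + 1) = ν + 1 by omega]
    ring
  · rw [hval n (by omega), if_neg (by omega : n ≠ 0), if_neg (by omega), zero_add]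
  · rw [hval n (by omega), if_neg (by omega : n ≠ 0), if_pos (by omega),
      show 2 * (ν + 1) - n = 2 * ν - n + 2 by omega, add_sub_cancel_left]
end
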